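/- Laurent series expansion: let 0 ≤ ξ₁ < ξ₂ ≤ ∞ and let f be monogenic on the spherical shell Ω = {x ∈ ℝ³ : ξ₁ < |x| < ξ₂}. With the unified family A_k^l for k ∈ ℤ ∖ {−1} (A_k^l the inner Appell polynomial for k ≥ 0 with 0 ≤ l ≤ k, and A_k^l the outer Appell function with n = −k−2 for k ≤ −2 with 0 ≤ l ≤ −k−2), define for any ρ ∈ (ξ₁, ξ₂) the Laurent coefficients γ_{k,l} = (|k+1|/(4^{l+1}·π))·∫_{S²_ρ} conj(A_{−(k+2)}^l(ȳ))·(y/|y|)·f(y) dσ(y), where S²_ρ = {y : |y| = ρ} with surface measure σ and ȳ is the conjugate reduced quaternion of y. Then γ_{k,l} does not depend on the choice of ρ ∈ (ξ₁, ξ₂), and for every x ∈ Ω, f(x) = Σ_{k ∈ ℤ, k ≠ −1} Σ_{l=0}^{|k+1|−1} A_k^l(x)·γ_{k,l}, the series converging pointwise in Ω. -/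

import Mathlib

open MeasureTheory Metric Finset

noncomputable section

/-- `ℝ³` with the Euclidean norm and Lebesgue measure. -/
abbrev R3 := EuclideanSpace ℝ (Fin 3)
/-- the real quaternions ℍ -/
abbrev QH := Quaternion ℝ

/-- the basis quaternion e₁ -/
def e1 : QH := ⟨0,1,0,0⟩
/-- the basis quaternion e₂ -/
def e2 : QH := ⟨0,0,1,0⟩
/-- the basis quaternion e₃ -/
def e3 : QH := ⟨0,0,0,1⟩

/-- embed a point of ℝ³ as the reduced quaternion x₀ + x₁e₁ + x₂e₂ -/
def toQ (x : R3) : QH := ⟨x 0, x 1, x 2, 0⟩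
/-- the conjugate reduced quaternion x₀ - x₁e₁ - x₂e₂ -/
def toQbar (x : R3) : QH := ⟨x 0, -(x 1), -(x 2), 0⟩
/-- ζ = x₁ - x₂e₃ -/
def zeta (x : R3) : QH := ⟨x 1, 0, 0, -(x 2)⟩

/-- build a point of ℝ³ from coordinates -/
def mk3 (a b c : ℝ) : R3 := (WithLp.equiv 2 (Fin 3 → ℝ)).symm ![a, b, c]

/-- the conjugated point (x₀, -x₁, -x₂) -/
def barPt (x : R3) : R3 := mk3 (x 0) (-(x 1)) (-(x 2))

/-- partial derivative ∂f/∂xᵢ -/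
def pd (i : Fin 3) (f : R3 → QH) (x : R3) : QH :=
  fderiv ℝ f x (EuclideanSpace.single i 1)

/-- the generalized Cauchy-Riemann operator ∂̄f = ∂f/∂x₀ + e₁∂f/∂x₁ + e₂∂f/∂x₂ -/
def CRbar (f : R3 → QH) (x : R3) : QH :=
  pd 0 f x + e1 * pd 1 f x + e2 * pd 2 f x

/-- the adjoint generalized Cauchy-Riemann operator ∂f = ∂f/∂x₀ - e₁∂f/∂x₁ - e₂∂f/∂x₂ -/
def Dadj (f : R3 → QH) (x : R3) : QH :=
  pd 0 f x - e1 * pd 1 f x - e2 * pd 2 f x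

/-- the hypercomplex derivative ∂₀ = (1/2)∂ -/
def D0 (f : R3 → QH) : R3 → QH := fun x =>
  (1/2 : ℝ) • (pd 0 f x - e1 * pd 1 f x - e2 * pd 2 f x)

/-- the operator ∂̄_ℂ f = (1/2)(∂f/∂x₁ + e₃∂f/∂x₂) -/
def DbarC (f : R3 → QH) : R3 → QH := fun x =>
  (1/2 : ℝ) • (pd 1 f x + e3 * pd 2 f x)

/-- the involution f⁰ + f¹e₁ + f²e₂ + f³e₃ ↦ f⁰ - f¹e₁ - f²e₂ + f³e₃ -/
def invol (a : QH) : QH := ⟨a.re, -a.imI, -a.imJ, a.imK⟩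

/-- the inner Appell polynomial A_n^l -/
def appell (n l : ℕ) (x : R3) : QH :=
  ((n.factorial * l.factorial : ℝ) /
      (2 ^ (2 * (n - l)) * (n + l + 1).factorial * (2 * l).factorial)) •
    ((∑ h ∈ Finset.range (n - l + 1),
        (((2 * n - 2 * h + 1).factorial * (2 * l + 2 * h).factorial : ℝ) /
            (h.factorial * (n - l - h).factorial * (n - h).factorial * (l + h).factorial)) •
          (toQbar x ^ h * toQ x ^ (n - l - h))) * zeta x ^ l)

/-- the Kelvin transform K(P)(x) = (x̄/|x|³)·P(x̄/|x|²) -/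
def kelvin (P : R3 → QH) (x : R3) : QH :=
  ((‖x‖ ^ 3)⁻¹ • toQbar x) * P ((‖x‖ ^ 2)⁻¹ • barPt x)

/-- the outer Appell function A_{-(n+2)}^l -/
def outerAppell (n l : ℕ) (x : R3) : QH :=
  (((n + l + 1).factorial * (n - l).factorial : ℝ) / (n.factorial * (n + 1).factorial)) •
    kelvin (appell n l) x

/-- surface integral over the sphere of radius ρ (parametrized by the unit sphere
with its surface measure, with the Jacobian factor ρ²) -/
def sphereIntegral (ρ : ℝ) (g : R3 → QH) : QH :=
  ∫ ω : sphere (0 : R3) 1, (ρ ^ 2) • g (ρ • (ω : R3)) ∂((volume : Measure R3).toSphere)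

/-- the unified family ψ_k^l, k ∈ ℤ \ {-1}: inner Appell polynomials for k ≥ 0,
outer Appell functions for k ≤ -2 -/
def psiFam (k : ℤ) (l : ℕ) (x : R3) : QH :=
  if 0 ≤ k then appell k.toNat l x else outerAppell (-k - 2).toNat l x

/-- the Laurent coefficient γ_{k,l} computed as a surface integral over the sphere of
radius ρ -/
def laurentCoeff (f : R3 → QH) (ρ : ℝ) (k : ℤ) (l : ℕ) : QH :=
  (((k + 1).natAbs : ℝ) / (4 ^ (l + 1) * Real.pi)) •
    sphereIntegral ρ
      (fun y => star (psiFam (-(k + 2)) l (barPt y)) * ((‖y‖⁻¹ • toQ y) * f y))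

open scoped Quaternion ContDiff

/-- The coefficients `(a)ₙ / n!` of the binomial series `(1 - z)^(-a)`. -/
def binCoeff (a : ℝ) : ℕ → ℝ
  | 0 => 1
  | n + 1 => binCoeff a n * ((a + n) / (n + 1))

/-- Homogenised Gegenbauer polynomials, shifted by one: `gegen a p q (m + 1)` is the coefficient
of `s ^ m` in `(1 - 2 p s + q s²)^(-a)`. -/
def gegen (a p q : ℝ) : ℕ → ℝ
  | 0 => 0
  | 1 => 1
  | m + 2 => (2 * (m + a) * p * gegen a p q (m + 1) - (m - 1 + 2 * a) * q * gegen a p q m) / (m + 1)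

/-- The derivative of `gegen a p q m` with respect to `p`. -/
def gegenP (a p q : ℝ) : ℕ → ℝ
  | 0 => 0
  | 1 => 0
  | m + 2 => (2 * (m + a) * (gegen a p q (m + 1) + p * gegenP a p q (m + 1))
      - (m - 1 + 2 * a) * q * gegenP a p q m) / (m + 1)

lemma binCoeff_succ_mul (a : ℝ) (n : ℕ) :
    ((n : ℝ) + 1) * binCoeff a (n + 1) = (a + n) * binCoeff a n := by
  rw [binCoeff]
  field_simp

lemma gegen_succ_succ_mul (a p q : ℝ) (m : ℕ) :
    ((m : ℝ) + 1) * gegen a p q (m + 2) =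
      2 * (m + a) * p * gegen a p q (m + 1) - (m - 1 + 2 * a) * q * gegen a p q m := by
  rw [gegen]
  field_simp

lemma gegenP_succ_succ_mul (a p q : ℝ) (m : ℕ) :
    ((m : ℝ) + 1) * gegenP a p q (m + 2) =
      2 * (m + a) * (gegen a p q (m + 1) + p * gegenP a p q (m + 1))
      - (m - 1 + 2 * a) * q * gegenP a p q m := by
  rw [gegenP]
  field_simp

lemma gegenP_relations (a p q : ℝ) (m : ℕ) :
    gegenP a p q (m + 1) = (m - 1 + 2 * a) * gegen a p q m + p * gegenP a p q m ∧
    gegenP a p q (m + 2) = (m + 2 * a) * gegen a p q (m + 1) + p * gegenP a p q (m + 1) ∧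
    m * gegen a p q (m + 1) = p * gegenP a p q (m + 1) - q * gegenP a p q m := by
  induction m with
  | zero =>
    refine ⟨by simp [gegen, gegenP], ?_, by simp [gegenP]⟩
    simp [gegen, gegenP]
  | succ m ih =>
    obtain ⟨h1, h2, h3⟩ := ih
    have e4 : ((m : ℝ) + 1) * gegen a p q (m + 2) =
        p * gegenP a p q (m + 2) - q * gegenP a p q (m + 1) := by
      have := gegen_succ_succ_mul a p q m
      linear_combination this - p * h2 + q * h1 + p * h3
    refine ⟨by push_cast; linear_combination h2, ?_, by push_cast; exact e4⟩
    have h := gegenP_succ_succ_mul a p q (m + 1)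
    have hm : ((m : ℝ) + 2) ≠ 0 := by positivity
    apply mul_left_cancel₀ hm
    push_cast at h ⊢
    linear_combination h - (m + 2 * a) * e4

lemma gegenP_succ (a p q : ℝ) (m : ℕ) :
    gegenP a p q (m + 1) = (m - 1 + 2 * a) * gegen a p q m + p * gegenP a p q m :=
  (gegenP_relations a p q m).1

lemma mul_gegen_succ (a p q : ℝ) (m : ℕ) :
    m * gegen a p q (m + 1) = p * gegenP a p q (m + 1) - q * gegenP a p q m :=
  (gegenP_relations a p q m).2.2

lemma hasDerivAt_gegen_succ (a : ℝ) {P Q : ℝ → ℝ} {P' Q' t : ℝ} (hP : HasDerivAt P P' t)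
    (hQ : HasDerivAt Q Q' t) (m : ℕ) :
    HasDerivAt (fun s => gegen a (P s) (Q s) (m + 1))
      (gegenP a (P t) (Q t) (m + 1) * P' - 1 / 2 * gegenP a (P t) (Q t) m * Q') t := by
  induction m using Nat.twoStepInduction with
  | zero => simpa [gegen, gegenP] using hasDerivAt_const t (1 : ℝ)
  | one =>
    have h : (fun s => gegen a (P s) (Q s) (1 + 1)) = fun s => 2 * a * P s := by
      ext s
      simp [gegen]
    rw [h]
    exact (hP.const_mul (2 * a)).congr_deriv (by simp [gegen, gegenP])
  | more m ih1 ih2 =>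
    have h := ((((hP.const_mul (2 * ((m + 1 : ℕ) + a))).mul ih2).sub
      ((hQ.const_mul (((m + 1 : ℕ) : ℝ) - 1 + 2 * a)).mul ih1)).div_const (((m + 1 : ℕ) : ℝ) + 1))
    refine h.congr_deriv ?_
    have e1 := gegenP_succ_succ_mul a (P t) (Q t) (m + 1)
    have e2 := gegenP_succ a (P t) (Q t) (m + 1)
    have e3 := mul_gegen_succ a (P t) (Q t) m
    have hm : ((m : ℝ) + 1 + 1) ≠ 0 := by positivity
    push_cast at e1 e2 e3 ⊢
    rw [div_eq_iff hm]
    have hn : m + 2 + 1 = m + 1 + 2 := rfl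
    have hn' : m + 2 = m + 1 + 1 := rfl
    rw [hn, hn']
    linear_combination -P' * e1 + Q' / 2 * (m + 2) * e2 + Q' / 2 * (m + 2 * a) * e3

lemma hasDerivAt_gegen (a : ℝ) {P Q : ℝ → ℝ} {P' Q' t : ℝ} (hP : HasDerivAt P P' t)
    (hQ : HasDerivAt Q Q' t) (m : ℕ) :
    ∃ g', HasDerivAt (fun s => gegen a (P s) (Q s) m) g' t ∧
      g' = gegenP a (P t) (Q t) m * P' - 1 / 2 * gegenP a (P t) (Q t) (m - 1) * Q' := by
  cases m with
  | zero => exact ⟨0, by simpa [gegen] using hasDerivAt_const t (0 : ℝ), by simp [gegenP]⟩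
  | succ m => exact ⟨_, hasDerivAt_gegen_succ a hP hQ m, by simp⟩

section Convolution

variable {A : Type*} [CommRing A] [Algebra ℝ A]

/-- The binomial series `(1 - u X)^(-a)`. -/
def binSeries (a : ℝ) (u : A) : PowerSeries A := PowerSeries.mk fun i => binCoeff a i • u ^ i

lemma binSeries_deriv (a : ℝ) (u : A) :
    (1 - PowerSeries.C u * PowerSeries.X) * PowerSeries.derivative A (binSeries a u) =
      PowerSeries.C (a • u) * binSeries a u := by
  ext n
  rw [sub_mul, one_mul, mul_assoc, map_sub, PowerSeries.coeff_C_mul, PowerSeries.coeff_C_mul]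
  cases n with
  | zero =>
    simp [binSeries, binCoeff, PowerSeries.coeff_derivative, PowerSeries.coeff_zero_X_mul]
  | succ n =>
    rw [PowerSeries.coeff_succ_X_mul]
    simp only [PowerSeries.coeff_derivative, binSeries, PowerSeries.coeff_mk]
    have h := binCoeff_succ_mul a (n + 1)
    have h' := congrArg (algebraMap ℝ A) h
    simp only [Algebra.smul_def]
    simp only [map_mul, map_add, map_natCast, map_one] at h'
    push_cast at h' ⊢
    linear_combination u ^ (n + 1 + 1) * h'

lemma binSeries_sub_one (a : ℝ) (u : A) :
    (1 - PowerSeries.C u * PowerSeries.X) * binSeries a u = binSeries (a - 1) u := by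
  ext n
  rw [sub_mul, one_mul, mul_assoc, map_sub, PowerSeries.coeff_C_mul]
  cases n with
  | zero => simp [binSeries, binCoeff, PowerSeries.coeff_zero_X_mul]
  | succ n =>
    rw [PowerSeries.coeff_succ_X_mul]
    simp only [binSeries, PowerSeries.coeff_mk]
    have key : ∀ n : ℕ, binCoeff (a - 1) (n + 1) = binCoeff a (n + 1) - binCoeff a n := by
      intro n
      induction n with
      | zero => simp [binCoeff]
      | succ n ih =>
        have h1 := binCoeff_succ_mul (a - 1) (n + 1)
        have h2 := binCoeff_succ_mul a (n + 1)
        have h3 := binCoeff_succ_mul a n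
        have hm : (((n + 1 : ℕ) : ℝ) + 1) ≠ 0 := by positivity
        apply mul_left_cancel₀ hm
        rw [h1, ih]
        push_cast at h2 ⊢
        linear_combination -h2 + h3
    rw [key]
    simp only [Algebra.smul_def, map_sub]
    ring

/-- The coefficients of `(1 - u X)^(-a) (1 - v X)^(-b)`. -/
def binConv (a b : ℝ) (u v : A) (m : ℕ) : A :=
  PowerSeries.coeff m (binSeries a u * binSeries b v)

lemma binConv_eq_sum (a b : ℝ) (u v : A) (m : ℕ) :
    binConv a b u v m =
      ∑ ij ∈ antidiagonal m, (binCoeff a ij.1 * binCoeff b ij.2) • (u ^ ij.1 * v ^ ij.2) := by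
  rw [binConv, PowerSeries.coeff_mul]
  refine Finset.sum_congr rfl fun ij _ => ?_
  simp only [binSeries, PowerSeries.coeff_mk, smul_mul_smul_comm]

lemma binConv_recurrence (a : ℝ) (u v : A) (m : ℕ) :
    ((m : ℝ) + 2) • binConv a a u v (m + 2) =
      ((m : ℝ) + 1 + a) • ((u + v) * binConv a a u v (m + 1))
        - ((m : ℝ) + 2 * a) • (u * v * binConv a a u v m) := by
  have hu := binSeries_deriv a u
  have hv := binSeries_deriv a v
  set F := binSeries a u * binSeries a v with hF
  have hd : PowerSeries.derivative A F + (PowerSeries.C (u * v) *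
        (PowerSeries.X * (PowerSeries.X * PowerSeries.derivative A F)))
      - PowerSeries.C (u + v) * (PowerSeries.X * PowerSeries.derivative A F)
      = PowerSeries.C (a • (u + v)) * F
        - PowerSeries.C (a • (2 * (u * v))) * (PowerSeries.X * F) := by
    rw [hF, Derivation.leibniz]
    simp only [smul_eq_mul, map_add, map_mul, Algebra.smul_def] at hu hv ⊢
    rw [show PowerSeries.C (2 : A) = 2 from map_ofNat _ 2]
    linear_combination (1 - PowerSeries.C v * PowerSeries.X) * binSeries a v * hu
      + (1 - PowerSeries.C u * PowerSeries.X) * binSeries a u * hv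
  have h := congrArg (PowerSeries.coeff (m + 1)) hd
  have hX : PowerSeries.coeff m (PowerSeries.X * PowerSeries.derivative A F) =
      PowerSeries.coeff m F * m := by
    cases m with
    | zero => simp [PowerSeries.coeff_zero_X_mul]
    | succ m => rw [PowerSeries.coeff_succ_X_mul, PowerSeries.coeff_derivative]; push_cast; ring
  rw [map_sub, map_sub, map_add] at h
  simp only [PowerSeries.coeff_C_mul, PowerSeries.coeff_succ_X_mul, hX,
    PowerSeries.coeff_derivative] at h
  simp only [binConv, ← hF, Algebra.smul_def, map_add, map_natCast, map_one, map_mul,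
    map_ofNat] at h ⊢
  push_cast at h
  linear_combination h

lemma binConv_sub_one_succ (a b : ℝ) (u v : A) (m : ℕ) :
    binConv (a - 1) b u v (m + 1) = binConv a b u v (m + 1) - u * binConv a b u v m := by
  rw [binConv, ← binSeries_sub_one, sub_mul, one_mul, sub_mul, map_sub, mul_assoc, mul_assoc,
    PowerSeries.coeff_C_mul, PowerSeries.coeff_succ_X_mul, binConv, binConv]

end Convolution

@[simp] lemma toQ_re (x : R3) : (toQ x).re = x 0 := rfl
@[simp] lemma toQ_imI (x : R3) : (toQ x).imI = x 1 := rfl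
@[simp] lemma toQ_imJ (x : R3) : (toQ x).imJ = x 2 := rfl
@[simp] lemma toQ_imK (x : R3) : (toQ x).imK = 0 := rfl
@[simp] lemma toQbar_re (x : R3) : (toQbar x).re = x 0 := rfl
@[simp] lemma toQbar_imI (x : R3) : (toQbar x).imI = -x 1 := rfl
@[simp] lemma toQbar_imJ (x : R3) : (toQbar x).imJ = -x 2 := rfl
@[simp] lemma toQbar_imK (x : R3) : (toQbar x).imK = 0 := rfl
@[simp] lemma zeta_re (x : R3) : (zeta x).re = x 1 := rfl
@[simp] lemma zeta_imI (x : R3) : (zeta x).imI = 0 := rfl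
@[simp] lemma zeta_imJ (x : R3) : (zeta x).imJ = 0 := rfl
@[simp] lemma zeta_imK (x : R3) : (zeta x).imK = -x 2 := rfl
@[simp] lemma e1_re : e1.re = 0 := rfl
@[simp] lemma e1_imI : e1.imI = 1 := rfl
@[simp] lemma e1_imJ : e1.imJ = 0 := rfl
@[simp] lemma e1_imK : e1.imK = 0 := rfl
@[simp] lemma e2_re : e2.re = 0 := rfl
@[simp] lemma e2_imI : e2.imI = 0 := rfl
@[simp] lemma e2_imJ : e2.imJ = 1 := rfl
@[simp] lemma e2_imK : e2.imK = 0 := rfl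
@[simp] lemma e3_re : e3.re = 0 := rfl
@[simp] lemma e3_imI : e3.imI = 0 := rfl
@[simp] lemma e3_imJ : e3.imJ = 0 := rfl
@[simp] lemma e3_imK : e3.imK = 1 := rfl
@[simp] lemma barPt_zero (x : R3) : barPt x 0 = x 0 := rfl
@[simp] lemma barPt_one (x : R3) : barPt x 1 = -x 1 := rfl
@[simp] lemma barPt_two (x : R3) : barPt x 2 = -x 2 := rfl

/-- The homogeneous component of degree `m` of `(1 - w)^(-a) (1 - w̄)^(-b)`. -/
def qConv (a b : ℝ) (w : QH) (m : ℕ) : QH :=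
  ∑ ij ∈ antidiagonal m, (binCoeff a ij.1 * binCoeff b ij.2) • (w ^ ij.1 * star w ^ ij.2)

lemma aeval_two_re_sub (w : QH) {c : ℝ} (hc : c = 2 * w.re) :
    Polynomial.aeval w (Polynomial.C c - Polynomial.X) = star w := by
  rw [hc, map_sub, Polynomial.aeval_C, Polynomial.aeval_X, Quaternion.star_eq_two_re_sub]
  rfl

lemma qConv_eq_aeval (a b : ℝ) (w : QH) {c : ℝ} (hc : c = 2 * w.re) (m : ℕ) :
    qConv a b w m = Polynomial.aeval w
      (binConv a b Polynomial.X (Polynomial.C c - Polynomial.X) m) := by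
  rw [binConv_eq_sum, map_sum, qConv]
  refine Finset.sum_congr rfl fun ij _ => ?_
  rw [map_smul, map_mul, map_pow, map_pow, aeval_two_re_sub w hc, Polynomial.aeval_X]

lemma qConv_self (a : ℝ) (w : QH) (m : ℕ) :
    qConv a a w m = gegen a w.re (Quaternion.normSq w) (m + 1) • (1 : QH) := by
  induction m using Nat.twoStepInduction with
  | zero => simp [qConv, gegen, binCoeff]
  | one =>
    have : star w = (2 * w.re) • (1 : QH) - w := by
      rw [Quaternion.star_eq_two_re_sub, ← Quaternion.coe_mul_eq_smul, mul_one]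
    have h1 : antidiagonal 1 = {((0 : ℕ), (1 : ℕ)), (1, 0)} := rfl
    simp only [qConv, h1, gegen, binCoeff, Nat.cast_zero, Finset.sum_insert, Finset.mem_singleton,
      Prod.mk.injEq, zero_ne_one, one_ne_zero, and_self, not_false_eq_true, Finset.sum_singleton,
      pow_zero, pow_one, one_mul, mul_one, this]
    module
  | more m ih1 ih2 =>
    obtain ⟨c, hc⟩ : ∃ c, c = 2 * w.re := ⟨_, rfl⟩
    have h := congrArg (Polynomial.aeval w)
      (binConv_recurrence a Polynomial.X (Polynomial.C c - Polynomial.X) m)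
    rw [map_smul, map_sub, map_smul, map_smul, map_mul, map_mul, map_mul, map_add,
      aeval_two_re_sub w hc, Polynomial.aeval_X, ← qConv_eq_aeval a a w hc,
      ← qConv_eq_aeval a a w hc, ← qConv_eq_aeval a a w hc,
      ih1, ih2, Quaternion.self_add_star', Quaternion.self_mul_star, Quaternion.coe_mul_eq_smul,
      Quaternion.coe_mul_eq_smul, smul_smul, smul_smul, smul_smul, smul_smul, ← sub_smul] at h
    have hm : ((m : ℝ) + 2) ≠ 0 := by positivity
    have g := gegen_succ_succ_mul a w.re (Quaternion.normSq w) (m + 1)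
    apply smul_right_injective QH hm
    simp only
    rw [h, smul_smul]
    congr 1
    push_cast at g
    rw [show m + 2 + 1 = m + 1 + 2 from rfl]
    linear_combination -g

lemma qConv_sub_one (a : ℝ) (w : QH) (m : ℕ) :
    qConv (a - 1) a w m = gegen a w.re (Quaternion.normSq w) (m + 1) • (1 : QH)
      - gegen a w.re (Quaternion.normSq w) m • w := by
  cases m with
  | zero => simp [qConv, gegen, binCoeff]
  | succ m =>
    obtain ⟨c, hc⟩ : ∃ c, c = 2 * w.re := ⟨_, rfl⟩
    rw [qConv_eq_aeval _ _ w hc, binConv_sub_one_succ, map_sub, map_mul,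
      ← qConv_eq_aeval a a w hc, ← qConv_eq_aeval a a w hc, Polynomial.aeval_X, qConv_self, qConv_self, mul_smul_comm, mul_one]

/-- The basis `1, e₁, e₂` of the reduced quaternions. -/
def eB : Fin 3 → QH := ![1, e1, e2]

lemma CRbar_eq_sum (f : R3 → QH) (x : R3) : CRbar f x = ∑ i, eB i * pd i f x := by
  simp [CRbar, eB, Fin.sum_univ_three]

lemma toQ_single (i : Fin 3) : toQ (EuclideanSpace.single i 1) = eB i := by
  fin_cases i <;> ext <;> simp [eB, EuclideanSpace.single]

lemma toQbar_eq_star (x : R3) : toQbar x = star (toQ x) := by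
  ext <;> simp

/-- The embedding of `ℝ³` into `ℍ` as a linear map. -/
def toQL : R3 →ₗ[ℝ] QH where
  toFun := toQ
  map_add' x y := by ext <;> simp
  map_smul' c x := by ext <;> simp

lemma toQ_add (x y : R3) : toQ (x + y) = toQ x + toQ y := toQL.map_add x y
lemma toQ_sub (x y : R3) : toQ (x - y) = toQ x - toQ y := toQL.map_sub x y
lemma toQ_smul (c : ℝ) (x : R3) : toQ (c • x) = c • toQ x := toQL.map_smul c x

lemma toQbar_add (x y : R3) : toQbar (x + y) = toQbar x + toQbar y := by
  simp [toQbar_eq_star, toQ_add]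
lemma toQbar_sub (x y : R3) : toQbar (x - y) = toQbar x - toQbar y := by
  simp [toQbar_eq_star, toQ_sub]
lemma toQbar_smul (c : ℝ) (x : R3) : toQbar (c • x) = c • toQbar x := by
  rw [toQbar_eq_star, toQ_smul, Quaternion.star_smul, toQbar_eq_star]

/-- The conjugation of `ℝ³` as a linear map. -/
def barL : R3 →ₗ[ℝ] R3 where
  toFun := barPt
  map_add' x y := by ext i; fin_cases i <;> simp [add_comm]
  map_smul' c x := by ext i; fin_cases i <;> simp

/-- `ζ` as a linear map. -/
def zetaL : R3 →ₗ[ℝ] QH where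
  toFun := zeta
  map_add' x y := by ext <;> simp [add_comm]
  map_smul' c x := by ext <;> simp

lemma zeta_add (x y : R3) : zeta (x + y) = zeta x + zeta y := zetaL.map_add x y
lemma zeta_smul (c : ℝ) (x : R3) : zeta (c • x) = c • zeta x := zetaL.map_smul c x

lemma contDiff_toQ {n : WithTop ℕ∞} : ContDiff ℝ n toQ :=
  (LinearMap.toContinuousLinearMap toQL).contDiff
lemma contDiff_barPt {n : WithTop ℕ∞} : ContDiff ℝ n barPt :=
  (LinearMap.toContinuousLinearMap barL).contDiff
lemma contDiff_zeta {n : WithTop ℕ∞} : ContDiff ℝ n zeta :=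
  (LinearMap.toContinuousLinearMap zetaL).contDiff
lemma contDiff_quaternion_star {n : WithTop ℕ∞} : ContDiff ℝ n (star : QH → QH) :=
  (LinearMap.toContinuousLinearMap { toFun := star
                                     map_add' := star_add
                                     map_smul' := Quaternion.star_smul }).contDiff
lemma contDiff_toQbar {n : WithTop ℕ∞} : ContDiff ℝ n toQbar := by
  rw [funext toQbar_eq_star]
  exact contDiff_quaternion_star.comp contDiff_toQ

lemma normSq_toQ (x : R3) : Quaternion.normSq (toQ x) = ‖x‖ ^ 2 := by
  rw [Quaternion.normSq_def', EuclideanSpace.norm_sq_eq]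
  simp [toQ, Fin.sum_univ_three]

lemma norm_toQ (x : R3) : ‖toQ x‖ = ‖x‖ := by
  have h := normSq_toQ x
  rw [Quaternion.normSq_eq_norm_mul_self, ← sq] at h
  exact (sq_eq_sq₀ (norm_nonneg _) (norm_nonneg _)).1 h

lemma norm_toQbar (x : R3) : ‖toQbar x‖ = ‖x‖ := by
  rw [toQbar_eq_star, norm_star, norm_toQ]

lemma toQ_mul_toQbar (x : R3) : toQ x * toQbar x = ((‖x‖ ^ 2 : ℝ)) • (1 : QH) := by
  rw [toQbar_eq_star, Quaternion.self_mul_star, normSq_toQ, ← Quaternion.coe_mul_eq_smul, mul_one]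

lemma toQbar_mul_toQ (x : R3) : toQbar x * toQ x = ((‖x‖ ^ 2 : ℝ)) • (1 : QH) := by
  rw [toQbar_eq_star, Quaternion.star_mul_self, normSq_toQ, ← Quaternion.coe_mul_eq_smul, mul_one]

lemma toQbar_barPt (x : R3) : toQbar (barPt x) = toQ x := by
  ext <;> simp

lemma toQ_barPt (x : R3) : toQ (barPt x) = toQbar x := by
  ext <;> simp

lemma barPt_barPt (x : R3) : barPt (barPt x) = x := by
  ext i; fin_cases i <;> simp

lemma norm_barPt (x : R3) : ‖barPt x‖ = ‖x‖ := by
  rw [← norm_toQ, toQ_barPt, norm_toQbar]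

lemma pd_eq_of_hasDerivAt {f : R3 → QH} {x : R3} (hf : DifferentiableAt ℝ f x) {i : Fin 3}
    {f' : QH} (h : HasDerivAt (fun t : ℝ => f (x + t • EuclideanSpace.single i 1)) f' 0) :
    pd i f x = f' :=
  HasDerivAt.unique (hf.hasFDerivAt.hasLineDerivAt _) h

lemma hasDerivAt_line {f : R3 → QH} {x : R3} (hf : DifferentiableAt ℝ f x) (i : Fin 3) :
    HasDerivAt (fun t : ℝ => f (x + t • EuclideanSpace.single i 1)) (pd i f x) 0 :=
  hf.hasFDerivAt.hasLineDerivAt _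

lemma hasDerivAt_qConv_line (a : ℝ) (m : ℕ) (w v : QH) :
    HasDerivAt (fun t : ℝ => qConv (a - 1) a (w + t • v) m)
      ((gegenP a w.re (Quaternion.normSq w) (m + 1) * v.re
          - gegenP a w.re (Quaternion.normSq w) m * (w * star v).re) • (1 : QH)
        - ((gegenP a w.re (Quaternion.normSq w) m * v.re
          - gegenP a w.re (Quaternion.normSq w) (m - 1) * (w * star v).re) • w
          + gegen a w.re (Quaternion.normSq w) m • v)) 0 := by
  have hP : HasDerivAt (fun t : ℝ => (w + t • v).re) v.re 0 := by
    have : (fun t : ℝ => (w + t • v).re) = fun t => w.re + t * v.re := by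
      ext t; simp
    rw [this]
    simpa using ((hasDerivAt_id (0 : ℝ)).mul_const v.re).const_add w.re
  have hQ : HasDerivAt (fun t : ℝ => Quaternion.normSq (w + t • v)) (2 * (w * star v).re) 0 := by
    have : (fun t : ℝ => Quaternion.normSq (w + t • v)) =
        fun t => Quaternion.normSq w + t ^ 2 * Quaternion.normSq v + t * (2 * (w * star v).re) := by
      ext t
      rw [Quaternion.normSq_add, Quaternion.normSq_smul, Quaternion.star_smul,
        mul_smul_comm, Quaternion.re_smul, smul_eq_mul]
      ring
    rw [this]
    exact ((((hasDerivAt_pow 2 (0 : ℝ)).mul_const (Quaternion.normSq v)).const_add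
      (Quaternion.normSq w)).add
        ((hasDerivAt_id (0 : ℝ)).mul_const (2 * (w * star v).re))).congr_deriv (by simp)
  obtain ⟨g, hg, rfl⟩ := hasDerivAt_gegen a hP hQ m
  have hg1 := hasDerivAt_gegen_succ a hP hQ m
  have hw : HasDerivAt (fun t : ℝ => w + t • v) v 0 := by
    simpa using ((hasDerivAt_id (0 : ℝ)).smul_const v).const_add w
  have h := (hg1.smul_const (1 : QH)).sub (hg.smul hw)
  simp only [qConv_sub_one]
  refine h.congr_deriv ?_
  simp only [zero_smul, add_zero]
  module

lemma sum_eB_gegen (A B C D g : ℝ) (x y : R3)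
    (h1 : A - 2 * (toQbar x * toQ y).re * B + D * Quaternion.normSq (toQbar x * toQ y) = C * g)
    (w : QH) (hw : w = toQbar x * toQ y) (v : Fin 3 → QH) (hv : ∀ i, v i = star (eB i) * toQ y) :
    ∑ i, eB i * ((A * (v i).re - B * (w * star (v i)).re) • (1 : QH)
        - ((B * (v i).re - D * (w * star (v i)).re) • w + g • v i)) = ((C - 3) * g) • toQ y := by
  subst hw
  simp only [hv, Fin.sum_univ_three, eB, Quaternion.normSq_def'] at *
  simp at h1
  ext <;> simp
  · linear_combination y 0 * h1
  · linear_combination y 1 * h1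
  · linear_combination y 2 * h1
  · ring

theorem CRbar_qConv_mul (a : ℝ) (m : ℕ) (y : R3) {h : R3 → QH} (hd : Differentiable ℝ h) (x : R3)
    (h1 : CRbar h x = 0)
    (h2 : ∑ i, eB i * (toQbar x * toQ y * pd i h x) = (2 * a - 3) • (toQ y * h x)) :
    CRbar (fun x => qConv (a - 1) a (toQbar x * toQ y) m * h x) x = 0 := by
  have hdiff : DifferentiableAt ℝ (fun x => qConv (a - 1) a (toQbar x * toQ y) m * h x) x := by
    have := (contDiff_toQbar (n := 1)).differentiable (by simp)
    have hs := (contDiff_quaternion_star (n := 1)).differentiable (by simp)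
    unfold qConv
    refine DifferentiableAt.mul ?_ (hd x)
    refine DifferentiableAt.fun_sum fun ij _ => ?_
    refine DifferentiableAt.fun_const_smul (DifferentiableAt.fun_mul ?_ ?_) _
    · fun_prop
    · exact (hs.comp (by fun_prop : Differentiable ℝ fun x => toQbar x * toQ y)).pow _ x
  set w := toQbar x * toQ y with hw
  have key : ∀ i, pd i (fun x => qConv (a - 1) a (toQbar x * toQ y) m * h x) x = _ := fun i => by
    refine pd_eq_of_hasDerivAt hdiff ?_
    have e : ∀ t : ℝ, toQbar (x + t • EuclideanSpace.single i 1) * toQ y =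
        w + t • (star (eB i) * toQ y) := fun t => by
      rw [toQbar_add, toQbar_smul, add_mul, toQbar_eq_star (EuclideanSpace.single i 1), toQ_single,
        smul_mul_assoc]
    simp only [e]
    exact (hasDerivAt_qConv_line a m w (star (eB i) * toQ y)).mul (hasDerivAt_line (hd x) i)
  rw [CRbar_eq_sum] at h1 ⊢
  simp only [key, zero_smul, add_zero, mul_add, Finset.sum_add_distrib]
  simp only [← mul_assoc, ← Finset.sum_mul]
  rw [sum_eB_gegen _ _ (2 * a) _ _ x y ?_ w hw _ (fun i => rfl)]
  · simp only [mul_assoc, qConv_sub_one, sub_mul, mul_sub, Finset.sum_sub_distrib, smul_mul_assoc,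
      mul_smul_comm, one_mul, ← Finset.smul_sum, h1] at h2 ⊢
    simp only [← mul_assoc, hw] at h2 ⊢
    rw [h2, smul_zero, zero_sub]
    module
  · rw [← hw, gegenP_succ]
    cases m with
    | zero => simp [gegen, gegenP]
    | succ m =>
      have := mul_gegen_succ a w.re (Quaternion.normSq w) m
      push_cast
      simp only [add_tsub_cancel_right]
      linear_combination this

lemma hasDerivAt_add_smul_pow {z v : QH} (hc : Commute v z) (l : ℕ) :
    HasDerivAt (fun t : ℝ => (z + t • v) ^ l) ((l : ℝ) • (v * z ^ (l - 1))) 0 := by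
  induction l with
  | zero => simpa using hasDerivAt_const (0 : ℝ) (1 : QH)
  | succ l ih =>
    have h1 : HasDerivAt (fun t : ℝ => z + t • v) v 0 := by
      simpa using ((hasDerivAt_id (0 : ℝ)).smul_const v).const_add z
    have := ih.fun_mul h1
    simp only [zero_smul, add_zero] at this
    simp only [pow_succ]
    refine this.congr_deriv ?_
    cases l with
    | zero => simp
    | succ l =>
      rw [Nat.add_sub_cancel, Nat.add_sub_cancel, smul_mul_assoc, mul_assoc, ← pow_succ,
        ← (hc.pow_right (l + 1)).eq]
      push_cast
      module

lemma commute_zeta (x y : R3) : Commute (zeta x) (zeta y) := by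
  ext <;> simp <;> ring

lemma differentiable_zeta_pow (l : ℕ) : Differentiable ℝ (fun x => zeta x ^ l) :=
  ((contDiff_zeta (n := 1)).differentiable (by simp)).fun_pow l

lemma pd_zeta_pow (l : ℕ) (i : Fin 3) (x : R3) :
    pd i (fun x => zeta x ^ l) x =
      (l : ℝ) • (zeta (EuclideanSpace.single i 1) * zeta x ^ (l - 1)) := by
  refine pd_eq_of_hasDerivAt (differentiable_zeta_pow l x) ?_
  simp only [zeta_add, zeta_smul]
  exact hasDerivAt_add_smul_pow (commute_zeta _ _) l

lemma CRbar_zeta_pow (l : ℕ) (x : R3) : CRbar (fun x => zeta x ^ l) x = 0 := by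
  rw [CRbar_eq_sum]
  simp only [pd_zeta_pow, mul_smul_comm, ← Finset.smul_sum, ← mul_assoc, ← Finset.sum_mul]
  have : ∑ i, eB i * zeta (EuclideanSpace.single i 1) = 0 := by
    rw [Fin.sum_univ_three]
    ext <;> simp [eB]
  rw [this, zero_mul, smul_zero]

lemma sum_eB_zeta_pow (l : ℕ) (x : R3) :
    ∑ i, eB i * (toQbar x * pd i (fun x => zeta x ^ l) x) = (2 * l : ℝ) • zeta x ^ l := by
  simp only [pd_zeta_pow, mul_smul_comm, ← Finset.smul_sum, ← mul_assoc, ← Finset.sum_mul]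
  have : ∑ i, eB i * toQbar x * zeta (EuclideanSpace.single i 1) = (2 : ℝ) • zeta x := by
    rw [Fin.sum_univ_three]
    ext <;> simp [eB] <;> ring
  rw [this]
  cases l with
  | zero => simp
  | succ l => rw [Nat.add_sub_cancel, smul_mul_assoc, ← pow_succ', smul_smul, mul_comm]

lemma factorial_div_eq_binCoeff_three_halves (l m : ℕ) :
    ((2 * l + 2 * m + 1).factorial : ℝ) / (m.factorial * (l + m).factorial) =
      (2 * l + 1).factorial / l.factorial * 4 ^ m * binCoeff (l + 3 / 2) m := by
  induction m with
  | zero => simp [binCoeff]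
  | succ m ih =>
    rw [pow_succ, binCoeff]
    have h : ((2 * l + 2 * (m + 1) + 1).factorial : ℝ) / ((m + 1).factorial * (l + (m + 1)).factorial)
       = ((2 * l + 2 * m + 1).factorial : ℝ) / (m.factorial * (l + m).factorial) *
          (4 * ((l + 3 / 2 + m) / (m + 1))) := by
      rw [show 2 * l + 2 * (m + 1) + 1 = (2 * l + 2 * m + 1) + 1 + 1 by ring, ← add_assoc l m 1]
      simp only [Nat.factorial_succ (2 * l + 2 * m + 1 + 1), Nat.factorial_succ (2 * l + 2 * m + 1),
        Nat.factorial_succ m, Nat.factorial_succ (l + m)]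
      push_cast
      field_simp
      ring
    rw [h, ih]; ring

lemma factorial_div_eq_binCoeff_half (l m : ℕ) :
    ((2 * l + 2 * m).factorial : ℝ) / (m.factorial * (l + m).factorial) =
      (2 * l).factorial / l.factorial * 4 ^ m * binCoeff (l + 1 / 2) m := by
  induction m with
  | zero => simp [binCoeff]
  | succ m ih =>
    rw [pow_succ, binCoeff]
    have h : ((2 * l + 2 * (m + 1)).factorial : ℝ) / ((m + 1).factorial * (l + (m + 1)).factorial)
       = ((2 * l + 2 * m).factorial : ℝ) / (m.factorial * (l + m).factorial) *
          (4 * ((l + 1 / 2 + m) / (m + 1))) := by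
      rw [show 2 * l + 2 * (m + 1) = (2 * l + 2 * m) + 1 + 1 by ring, ← add_assoc l m 1]
      simp only [Nat.factorial_succ (2 * l + 2 * m + 1), Nat.factorial_succ (2 * l + 2 * m),
        Nat.factorial_succ m, Nat.factorial_succ (l + m)]
      push_cast
      field_simp
      ring
    rw [h, ih]; ring

/-- The normalising constant relating `A_{l+m}^l` to `qConv`. -/
def appellConst (l m : ℕ) : ℝ :=
  (l + m).factorial * (2 * l + 1).factorial / ((2 * l + m + 1).factorial * l.factorial)

lemma appell_add (l m : ℕ) (x : R3) :
    appell (l + m) l x =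
      appellConst l m • (qConv (l + 1 / 2) (l + 3 / 2) (toQbar x) m * zeta x ^ l) := by
  rw [appell, Nat.add_sub_cancel_left, ← smul_mul_assoc, ← smul_mul_assoc, qConv,
    Finset.Nat.sum_antidiagonal_eq_sum_range_succ (fun i j =>
      (binCoeff (l + 1 / 2) i * binCoeff (l + 3 / 2) j) • (toQbar x ^ i * star (toQbar x) ^ j)) m]
  congr 1
  rw [Finset.smul_sum, Finset.smul_sum]
  refine Finset.sum_congr rfl fun h hh => ?_
  obtain ⟨j, rfl⟩ := Nat.exists_eq_add_of_le (Nat.lt_succ_iff.1 (Finset.mem_range.1 hh))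
  rw [Nat.add_sub_cancel_left, smul_smul, smul_smul]
  congr 1
  · rw [show 2 * (l + (h + j)) - 2 * h + 1 = 2 * l + 2 * j + 1 by omega,
      show l + (h + j) - h = l + j by omega, show l + (h + j) + l + 1 = 2 * l + (h + j) + 1 by ring]
    have h1 := factorial_div_eq_binCoeff_three_halves l j
    have h2 := factorial_div_eq_binCoeff_half l h
    have h3 : (((2 * l + 2 * j + 1).factorial : ℝ) * (2 * l + 2 * h).factorial) /
        (h.factorial * j.factorial * (l + j).factorial * (l + h).factorial) =
        ((2 * l + 2 * j + 1).factorial : ℝ) / (j.factorial * (l + j).factorial) *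
        (((2 * l + 2 * h).factorial : ℝ) / (h.factorial * (l + h).factorial)) := by
      field_simp
    rw [h3, h1, h2, appellConst, pow_mul, pow_add, show (2 : ℝ) ^ 2 = 4 by norm_num]
    field_simp
  · simp [toQbar_eq_star]

lemma exists_appell_eq (n l : ℕ) : ∃ c : ℝ, ∀ x : R3, appell n l x =
    c • (qConv (l + 1 / 2) (l + 3 / 2) (toQbar x) (n - l) * zeta x ^ l) := by
  rcases le_total l n with h | h
  · obtain ⟨m, rfl⟩ := Nat.exists_eq_add_of_le h
    exact ⟨_, fun x => by rw [Nat.add_sub_cancel_left]; exact appell_add l m x⟩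
  · refine ⟨(n.factorial * l.factorial : ℝ) / (2 ^ (2 * (n - l)) * (n + l + 1).factorial *
      (2 * l).factorial) * (((2 * n - 2 * 0 + 1).factorial * (2 * l + 2 * 0).factorial : ℝ) /
        ((0 : ℕ).factorial * (n - l - 0).factorial * (n - 0).factorial * (l + 0).factorial)),
      fun x => ?_⟩
    rw [appell, Nat.sub_eq_zero_of_le h]
    simp only [zero_add, Finset.sum_range_one, pow_zero, mul_one, qConv,
      Finset.Nat.antidiagonal_zero, Finset.sum_singleton, binCoeff]
    rw [smul_mul_assoc, smul_smul, one_smul, Nat.sub_self, pow_zero (toQ x), mul_one (1 : QH)]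

lemma contDiff_qConv (a b : ℝ) (m : ℕ) {n : WithTop ℕ∞} : ContDiff ℝ n (fun w => qConv a b w m) := by
  unfold qConv
  refine ContDiff.sum fun ij _ => ContDiff.const_smul _ ?_
  exact (contDiff_id.pow _).mul (contDiff_quaternion_star.pow _)

lemma contDiff_appell (n l : ℕ) {N : WithTop ℕ∞} : ContDiff ℝ N (appell n l) := by
  obtain ⟨c, hc⟩ := exists_appell_eq n l
  rw [funext hc]
  exact (((contDiff_qConv _ _ _).comp contDiff_toQbar).mul (contDiff_zeta.pow l)).const_smul c

lemma pd_const_smul (c : ℝ) {f : R3 → QH} {x : R3} (hf : DifferentiableAt ℝ f x) (i : Fin 3) :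
    pd i (fun x => c • f x) x = c • pd i f x := by
  simp only [pd]
  rw [fderiv_fun_const_smul hf]
  rfl

lemma CRbar_const_smul (c : ℝ) {f : R3 → QH} {x : R3} (hf : DifferentiableAt ℝ f x) :
    CRbar (fun x => c • f x) x = c • CRbar f x := by
  simp only [CRbar_eq_sum, pd_const_smul c hf, mul_smul_comm, Finset.smul_sum]

lemma CRbar_appell (n l : ℕ) (x : R3) : CRbar (appell n l) x = 0 := by
  obtain ⟨c, hc⟩ := exists_appell_eq n l
  rw [funext hc, CRbar_const_smul]
  · have h := CRbar_qConv_mul (l + 3 / 2) (n - l) (EuclideanSpace.single 0 1)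
      (differentiable_zeta_pow l) x (CRbar_zeta_pow l x) ?_
    · simp only [toQ_single, eB, Matrix.cons_val_zero, mul_one] at h
      rw [show (l : ℝ) + 3 / 2 - 1 = l + 1 / 2 by ring] at h
      rw [h, smul_zero]
    · simp only [toQ_single, eB, Matrix.cons_val_zero, mul_one, one_mul]
      rw [show 2 * ((l : ℝ) + 3 / 2) - 3 = 2 * l by ring]
      exact sum_eB_zeta_pow l x
  · exact (((contDiff_qConv _ _ _).comp contDiff_toQbar).mul (contDiff_zeta.pow l)).differentiable
      (n := 1) (by simp) x

lemma qConv_smul (a b c : ℝ) (w : QH) (m : ℕ) : qConv a b (c • w) m = c ^ m • qConv a b w m := by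
  simp only [qConv, Finset.smul_sum]
  refine Finset.sum_congr rfl fun ij hij => ?_
  rw [HasAntidiagonal.mem_antidiagonal] at hij
  rw [Quaternion.star_smul, smul_pow, smul_pow, smul_mul_smul_comm, ← pow_add, hij, smul_comm]

lemma appell_smul {n l : ℕ} (h : l ≤ n) (c : ℝ) (x : R3) :
    appell n l (c • x) = c ^ n • appell n l x := by
  obtain ⟨m, rfl⟩ := Nat.exists_eq_add_of_le h
  rw [appell_add, appell_add, toQbar_smul, qConv_smul, zeta_smul, smul_pow, smul_mul_smul_comm,
    ← pow_add, smul_comm, add_comm m l]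

lemma commute_quaternion_star (w : QH) : Commute w (star w) := by
  rw [commute_iff_eq, Quaternion.self_mul_star, Quaternion.star_mul_self]

lemma star_qConv (a b : ℝ) (w : QH) (m : ℕ) : star (qConv a b w m) = qConv a b (star w) m := by
  simp only [qConv, star_sum]
  refine Finset.sum_congr rfl fun ij _ => ?_
  rw [Quaternion.star_smul, star_mul, star_pow, star_pow, star_star]
  congr 1
  exact ((commute_quaternion_star w).pow_pow _ _).eq

/-- The zonal monogenic of degree `k`. -/
def zonal (k : ℕ) (x y : R3) : QH := qConv (1 / 2) (3 / 2) (toQbar x * toQ y) k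

lemma star_zonal (k : ℕ) (x y : R3) : star (zonal k x y) = zonal k y x := by
  rw [zonal, star_qConv, star_mul, zonal, toQbar_eq_star, toQbar_eq_star, star_star]

lemma CRbar_zonal (k : ℕ) (x y : R3) : CRbar (fun x => zonal k x y) x = 0 := by
  have hc : ∀ i, pd i (fun _ : R3 => (1 : QH)) x = 0 := fun i => by simp [pd]
  have := CRbar_qConv_mul (3 / 2) k y (h := fun _ => (1 : QH)) (differentiable_const _) x
    (by simp [CRbar_eq_sum, hc]) (by norm_num [hc])
  rw [show (3 : ℝ) / 2 - 1 = 1 / 2 by norm_num] at this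
  simp only [mul_one] at this
  exact this

lemma zonal_smul_left (k : ℕ) (c : ℝ) (x y : R3) : zonal k (c • x) y = c ^ k • zonal k x y := by
  rw [zonal, toQbar_smul, smul_mul_assoc, qConv_smul, zonal]

lemma contDiff_zonal_left (k : ℕ) (y : R3) {n : WithTop ℕ∞} : ContDiff ℝ n (fun x => zonal k x y) :=
  (contDiff_qConv _ _ _).comp (contDiff_toQbar.mul contDiff_const)

lemma contDiff_pd {P : R3 → QH} (hP : ContDiff ℝ ∞ P) (i : Fin 3) : ContDiff ℝ ∞ (pd i P) :=
  (hP.fderiv_right (m := ∞) (by simp)).clm_apply contDiff_const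

lemma pd_comm {P : R3 → QH} (hP : ContDiff ℝ ∞ P) (i j : Fin 3) (x : R3) :
    pd i (pd j P) x = pd j (pd i P) x := by
  have hd : DifferentiableAt ℝ (fderiv ℝ P) x :=
    (hP.fderiv_right (m := ∞) (by simp)).differentiable (by simp) x
  have key : ∀ i j : Fin 3, pd i (pd j P) x =
      fderiv ℝ (fderiv ℝ P) x (EuclideanSpace.single i 1) (EuclideanSpace.single j 1) := by
    intro i j
    change fderiv ℝ (fun z => fderiv ℝ P z (EuclideanSpace.single j 1)) x _ = _
    rw [fderiv_clm_apply hd (differentiableAt_const _)]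
    simp
  rw [key, key]
  exact (hP.contDiffAt.isSymmSndFDerivAt (by
    rw [minSmoothness_of_isRCLikeNormedField]
    exact WithTop.coe_le_coe.2 (le_top : (2 : ℕ∞) ≤ ⊤))).eq _ _

lemma pd_const_mul (c : QH) {f : R3 → QH} {x : R3} (hf : DifferentiableAt ℝ f x) (i : Fin 3) :
    pd i (fun x => c * f x) x = c * pd i f x := by
  simp only [pd]
  rw [fderiv_const_mul hf]
  rfl

lemma pd_mul_const (c : QH) {f : R3 → QH} {x : R3} (hf : DifferentiableAt ℝ f x) (i : Fin 3) :
    pd i (fun x => f x * c) x = pd i f x * c := by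
  simp only [pd]
  rw [fderiv_mul_const' hf]
  rfl

lemma pd_sum {ι : Type*} (s : Finset ι) {f : ι → R3 → QH} {x : R3}
    (hf : ∀ j ∈ s, DifferentiableAt ℝ (f j) x) (i : Fin 3) :
    pd i (fun x => ∑ j ∈ s, f j x) x = ∑ j ∈ s, pd i (f j) x := by
  simp only [pd]
  rw [fderiv_fun_sum hf]
  simp

lemma pd_sub {f g : R3 → QH} {x : R3} (hf : DifferentiableAt ℝ f x) (hg : DifferentiableAt ℝ g x)
    (i : Fin 3) : pd i (fun x => f x - g x) x = pd i f x - pd i g x := by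
  simp only [pd]
  rw [fderiv_fun_sub hf hg]
  rfl

lemma CRbar_pd {P : R3 → QH} (hP : ContDiff ℝ ∞ P) (h : ∀ x, CRbar P x = 0) (j : Fin 3) (x : R3) :
    CRbar (pd j P) x = 0 := by
  have hd : ∀ i, DifferentiableAt ℝ (pd i P) x := fun i =>
    (contDiff_pd hP i).differentiable (by simp) x
  have h0 : pd j (fun x => ∑ i, eB i * pd i P x) x = 0 := by
    simp only [← CRbar_eq_sum, h]
    simp [pd]
  rw [pd_sum _ fun i _ => (differentiableAt_const _).fun_mul (hd i)] at h0
  rw [CRbar_eq_sum, ← h0]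
  refine Finset.sum_congr rfl fun i _ => ?_
  rw [pd_const_mul _ (hd i), pd_comm hP]

/-- A homogeneous monogenic function vanishing on the plane `x₀ = 0` vanishes identically. -/
theorem eq_zero_of_CRbar_of_plane (k : ℕ) {P : R3 → QH} (hP : ContDiff ℝ ∞ P)
    (hhom : ∀ c : ℝ, c ≠ 0 → ∀ x, P (c • x) = c ^ k • P x) (hCR : ∀ x, CRbar P x = 0)
    (hplane : ∀ x : R3, x 0 = 0 → P x = 0) (x : R3) : P x = 0 := by
  induction k generalizing P x with
  | zero =>
    have h1 : Filter.Tendsto (fun c : ℝ => P (c • x)) (nhdsWithin 0 {0}ᶜ) (nhds (P ((0 : ℝ) • x))) :=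
      ((hP.continuous.comp (continuous_id.smul continuous_const)).tendsto 0).mono_left
        nhdsWithin_le_nhds
    have h2 : Filter.Tendsto (fun c : ℝ => P (c • x)) (nhdsWithin 0 {0}ᶜ) (nhds (P x)) := by
      refine tendsto_const_nhds.congr' ?_
      filter_upwards [self_mem_nhdsWithin] with c hc
      rw [hhom c hc, pow_zero, one_smul]
    rw [tendsto_nhds_unique h2 h1, zero_smul]
    exact hplane _ (by simp)
  | succ k ih =>
    have hd : Differentiable ℝ P := hP.differentiable (by simp)
    have hpd : ∀ x, pd 0 P x = 0 := by
      refine ih (contDiff_pd hP 0) ?_ (CRbar_pd hP hCR 0) ?_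
      · intro c hc x
        have h1 : pd 0 (fun x => P (c • x)) x = c • pd 0 P (c • x) := by
          simp only [pd]
          rw [fderiv_comp_smul]
          rfl
        have h2 : pd 0 (fun x => P (c • x)) x = c ^ (k + 1) • pd 0 P x := by
          simp only [hhom c hc]
          exact pd_const_smul _ (hd x) 0
        rw [h1, pow_succ', mul_smul] at h2
        exact smul_right_injective _ hc h2
      · intro x hx
        have h0 : ∀ i : Fin 3, i ≠ 0 → pd i P x = 0 := by
          intro i hi
          refine pd_eq_of_hasDerivAt (hd x) ?_
          have : (fun t : ℝ => P (x + t • EuclideanSpace.single i 1)) = fun _ => 0 := by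
            funext t
            apply hplane
            simp [hx, hi.symm]
          rw [this]
          exact hasDerivAt_const _ _
        have := hCR x
        rwa [CRbar, h0 1 (by simp), h0 2 (by simp), mul_zero, mul_zero, add_zero, add_zero] at this
    have hc : ∀ t : ℝ, HasDerivAt (fun t : ℝ => P (x + t • EuclideanSpace.single 0 1)) 0 t := by
      intro t
      have hl : HasDerivAt (fun t : ℝ => x + t • (EuclideanSpace.single 0 1 : R3))
          (EuclideanSpace.single 0 1) t := by
        simpa using ((hasDerivAt_id t).smul_const (EuclideanSpace.single 0 1 : R3)).const_add x
      have := (hd (x + t • EuclideanSpace.single 0 1)).hasFDerivAt.comp_hasDerivAt t hl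
      refine this.congr_deriv (hpd _)
    have h := is_const_of_deriv_eq_zero (fun t => (hc t).differentiableAt)
      (fun t => (hc t).deriv) 0 (- x 0)
    simp only [zero_smul, add_zero] at h
    rw [h]
    exact hplane _ (by simp)

lemma gegen_zero (a q : ℝ) (r : ℕ) :
    gegen a 0 q (2 * r) = 0 ∧ gegen a 0 q (2 * r + 1) = (-q) ^ r * binCoeff a r := by
  induction r with
  | zero => simp [gegen, binCoeff]
  | succ r ih =>
    have h1 : gegen a 0 q (2 * (r + 1)) = 0 := by
      have := gegen_succ_succ_mul a 0 q (2 * r)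
      rw [ih.1] at this
      simp only [mul_zero, zero_mul, sub_zero, mul_eq_zero] at this
      refine this.resolve_left ?_
      positivity
    refine ⟨h1, ?_⟩
    have := gegen_succ_succ_mul a 0 q (2 * r + 1)
    rw [ih.2] at this
    have h2 := binCoeff_succ_mul a r
    push_cast at this
    have h3 : (2 * ((r : ℝ) + 1)) ≠ 0 := by positivity
    refine mul_left_cancel₀ h3 ?_
    rw [show 2 * (r + 1) + 1 = 2 * r + 1 + 2 by ring, pow_succ]
    linear_combination this - 2 * (-q) ^ r * (-q) * h2

lemma appellConst_add_const_even (l r : ℕ) :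
    (((l + 2 * r : ℕ) : ℝ) + 1) / 4 ^ l * (((l + 2 * r + l + 1).factorial * (2 * r).factorial : ℝ) /
      ((l + 2 * r).factorial * (l + 2 * r + 1).factorial)) *
      (appellConst l (2 * r) * binCoeff (l + 3 / 2) r) ^ 2 =
    binCoeff (1 / 2) r * binCoeff (3 / 2) (l + r) := by
  have h1 := factorial_div_eq_binCoeff_three_halves l r
  have h2 := factorial_div_eq_binCoeff_three_halves 0 (l + r)
  have h3 := factorial_div_eq_binCoeff_half 0 r
  simp only [mul_zero, zero_add, Nat.factorial_zero, Nat.factorial_one, Nat.cast_one, div_one,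
    one_mul, Nat.cast_zero] at h2 h3
  have e1 : binCoeff (l + 3 / 2) r = ((2 * l + 2 * r + 1).factorial : ℝ) /
      (r.factorial * (l + r).factorial) * l.factorial / ((2 * l + 1).factorial * 4 ^ r) := by
    rw [h1]; field_simp
  have e2 : binCoeff (3 / 2) (l + r) = ((2 * (l + r) + 1).factorial : ℝ) /
      ((l + r).factorial * (l + r).factorial) / 4 ^ (l + r) := by rw [h2]; field_simp
  have e3 : binCoeff (1 / 2) r = ((2 * r).factorial : ℝ) / (r.factorial * r.factorial) / 4 ^ r := by
    rw [h3]; field_simp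
  rw [e1, e2, e3, appellConst, show l + 2 * r + l + 1 = 2 * l + 2 * r + 1 by ring,
    show 2 * (l + r) + 1 = 2 * l + 2 * r + 1 by ring, Nat.factorial_succ (l + 2 * r), pow_add]
  push_cast
  field_simp

lemma appellConst_add_const_odd (l r : ℕ) :
    (((l + (2 * r + 1) : ℕ) : ℝ) + 1) / 4 ^ l *
      (((l + (2 * r + 1) + l + 1).factorial * (2 * r + 1).factorial : ℝ) /
      ((l + (2 * r + 1)).factorial * (l + (2 * r + 1) + 1).factorial)) *
      (appellConst l (2 * r + 1) * binCoeff (l + 3 / 2) r) ^ 2 =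
    binCoeff (1 / 2) (l + r + 1) * binCoeff (3 / 2) r := by
  have h1 := factorial_div_eq_binCoeff_three_halves l r
  have h2 := factorial_div_eq_binCoeff_three_halves 0 r
  have h3 := factorial_div_eq_binCoeff_half 0 (l + r + 1)
  simp only [mul_zero, zero_add, Nat.factorial_zero, Nat.factorial_one, Nat.cast_one, div_one,
    one_mul, Nat.cast_zero] at h2 h3
  have e1 : binCoeff (l + 3 / 2) r = ((2 * l + 2 * r + 1).factorial : ℝ) /
      (r.factorial * (l + r).factorial) * l.factorial / ((2 * l + 1).factorial * 4 ^ r) := by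
    rw [h1]; field_simp
  have e2 : binCoeff (3 / 2) r = ((2 * r + 1).factorial : ℝ) /
      (r.factorial * r.factorial) / 4 ^ r := by rw [h2]; field_simp
  have e3 : binCoeff (1 / 2) (l + r + 1) = ((2 * (l + r + 1)).factorial : ℝ) /
      ((l + r + 1).factorial * (l + r + 1).factorial) / 4 ^ (l + r + 1) := by
    rw [h3]; field_simp
  rw [e1, e2, e3, appellConst, show l + (2 * r + 1) + l + 1 = 2 * l + 2 * r + 1 + 1 by ring,
    show 2 * l + (2 * r + 1) + 1 = 2 * l + 2 * r + 1 + 1 by ring,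
    show 2 * (l + r + 1) = 2 * l + 2 * r + 1 + 1 by ring, Nat.factorial_succ (l + (2 * r + 1)),
    Nat.factorial_succ (2 * l + 2 * r + 1), Nat.factorial_succ (l + r)]
  push_cast
  field_simp
  ring

lemma appell_plane_even {x : R3} (hx : x 0 = 0) (l r : ℕ) :
    appell (l + 2 * r) l x =
      (appellConst l (2 * r) * binCoeff (l + 3 / 2) r) • ((-‖x‖ ^ 2) ^ r • zeta x ^ l) := by
  have h := qConv_sub_one (l + 3 / 2) (toQbar x) (2 * r)
  rw [show (l : ℝ) + 3 / 2 - 1 = l + 1 / 2 by ring] at h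
  have h0 : (toQbar x).re = 0 := by simp [hx]
  rw [appell_add, h, h0, (gegen_zero _ _ r).1, (gegen_zero _ _ r).2, toQbar_eq_star,
    Quaternion.normSq_star, normSq_toQ, zero_smul, sub_zero, smul_mul_assoc, one_mul, smul_smul,
    smul_smul]
  congr 1
  ring

lemma appell_plane_odd {x : R3} (hx : x 0 = 0) (l r : ℕ) :
    appell (l + (2 * r + 1)) l x =
      (appellConst l (2 * r + 1) * binCoeff (l + 3 / 2) r) •
        ((-‖x‖ ^ 2) ^ r • (toQ x * zeta x ^ l)) := by
  have h := qConv_sub_one (l + 3 / 2) (toQbar x) (2 * r + 1)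
  rw [show (l : ℝ) + 3 / 2 - 1 = l + 1 / 2 by ring] at h
  have h0 : (toQbar x).re = 0 := by simp [hx]
  have h1 : toQbar x = - toQ x := by ext <;> simp [hx]
  rw [appell_add, h, h0, show 2 * r + 1 + 1 = 2 * (r + 1) by ring, (gegen_zero _ _ (r + 1)).1,
    (gegen_zero _ _ r).2, h1, Quaternion.normSq_neg, normSq_toQ, zero_smul, zero_sub, smul_neg,
    neg_neg, smul_mul_assoc, smul_smul, smul_smul]
  congr 1
  ring

lemma plane_even_product (x y : R3) (l : ℕ) :
    zeta x ^ l * star (zeta y ^ l) = star (star (zeta x) * zeta y) ^ l := by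
  have hc : Commute (zeta x) (star (zeta y)) := by
    ext <;> simp <;> ring
  rw [star_mul, star_star, ← hc.eq, hc.mul_pow, star_pow]

lemma plane_odd_product {x y : R3} (hx : x 0 = 0) (hy : y 0 = 0) (l : ℕ) :
    toQ x * zeta x ^ l * star (toQ y * zeta y ^ l) = (star (zeta x) * zeta y) ^ (l + 1) := by
  have h : ∀ {x : R3}, x 0 = 0 → toQ x = e1 * zeta x := by
    intro x hx
    ext <;> simp [hx]
  have hc : Commute (zeta x) (star (zeta y)) := by
    ext <;> simp <;> ring
  have he : e1 * star e1 = 1 := by ext <;> simp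
  have hcomm : e1 * (zeta x * star (zeta y)) = star (zeta x) * zeta y * e1 := by
    ext <;> simp <;> ring
  have hpow := SemiconjBy.pow_right (a := e1) (x := zeta x * star (zeta y))
    (y := star (zeta x) * zeta y) hcomm (l + 1)
  rw [h hx, h hy, mul_assoc e1 (zeta x), mul_assoc e1 (zeta y), ← pow_succ', ← pow_succ', star_mul,
    star_pow, mul_assoc e1, ← mul_assoc (zeta x ^ (l + 1)), ← hc.mul_pow, ← mul_assoc, hpow.eq, mul_assoc, he,
    mul_one]

lemma norm_plane {x : R3} (hx : x 0 = 0) : ‖zeta x‖ = ‖x‖ := by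
  have h : toQ x = e1 * zeta x := by ext <;> simp [hx]
  have he : ‖e1‖ = 1 := by
    have : Quaternion.normSq e1 = 1 := by simp [Quaternion.normSq_def']
    rw [Quaternion.normSq_eq_norm_mul_self] at this
    nlinarith [norm_nonneg e1]
  rw [← norm_toQ, h, norm_mul, he, one_mul]

/-- The coefficients of the addition theorem. -/
def additionConst (k l : ℕ) : ℝ :=
  ((k : ℝ) + 1) / 4 ^ l *
    (((k + l + 1).factorial * (k - l).factorial : ℝ) / (k.factorial * (k + 1).factorial))

lemma smul_one_pow_mul (w : QH) (r n : ℕ) :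
    (‖w‖ ^ 2) ^ r • w ^ n = w ^ (n + r) * star w ^ r ∧
    (‖w‖ ^ 2) ^ r • star w ^ n = w ^ r * star w ^ (n + r) := by
  have h : w ^ r * star w ^ r = (‖w‖ ^ 2) ^ r • (1 : QH) := by
    rw [← (commute_quaternion_star w).mul_pow, Quaternion.self_mul_star,
      Quaternion.normSq_eq_norm_mul_self, ← sq]
    rw [← Quaternion.coe_mul_eq_smul, mul_one, Quaternion.coe_pow, Quaternion.coe_pow,
      Quaternion.coe_pow]
  refine ⟨?_, ?_⟩
  · rw [pow_add, mul_assoc, h, mul_smul_comm, mul_one]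
  · rw [add_comm, pow_add, ← mul_assoc, h, smul_mul_assoc, one_mul]

lemma appell_mul_star_plane {x y : R3} (hx : x 0 = 0) (hy : y 0 = 0) {k l : ℕ} (hl : l ≤ k) :
    additionConst k l • (appell k l x * star (appell k l y)) =
      let i := if Even (k - l) then (k - l) / 2 else k - (k - l) / 2
      (binCoeff (1 / 2) i * binCoeff (3 / 2) (k - i)) •
        ((toQbar x * toQ y) ^ i * star (toQbar x * toQ y) ^ (k - i)) := by
  obtain ⟨m, rfl⟩ := Nat.exists_eq_add_of_le hl
  have hw : toQbar x * toQ y = star (zeta x) * zeta y := by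
    ext <;> simp [hx, hy]
  have hn : ‖star (zeta x) * zeta y‖ = ‖x‖ * ‖y‖ := by
    rw [norm_mul, norm_star, norm_plane hx, norm_plane hy]
  have hpow : ∀ r : ℕ, (-‖x‖ ^ 2) ^ r * (-‖y‖ ^ 2) ^ r = (‖star (zeta x) * zeta y‖ ^ 2) ^ r := by
    intro r
    rw [hn, ← mul_pow]
    ring
  rw [Nat.add_sub_cancel_left, hw]
  rcases Nat.even_or_odd' m with ⟨r, rfl | rfl⟩
  · have hi : (if Even (2 * r) then 2 * r / 2 else l + 2 * r - 2 * r / 2) = r := by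
      rw [if_pos (even_two_mul r)]; omega
    simp only [hi]
    rw [show l + 2 * r - r = l + r by omega, ← appellConst_add_const_even,
      ← (smul_one_pow_mul _ _ _).2, appell_plane_even hx, appell_plane_even hy, Quaternion.star_smul,
      Quaternion.star_smul, smul_mul_smul_comm, smul_mul_smul_comm, plane_even_product, hpow,
      smul_smul, additionConst, Nat.add_sub_cancel_left]
    congr 1
    ring
  · have hi : (if Even (2 * r + 1) then (2 * r + 1) / 2 else l + (2 * r + 1) - (2 * r + 1) / 2)
        = l + r + 1 := by
      rw [if_neg (by simp)]; omega
    simp only [hi]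
    rw [show l + (2 * r + 1) - (l + r + 1) = r by omega, ← appellConst_add_const_odd,
      show l + r + 1 = l + 1 + r by ring,
      ← (smul_one_pow_mul _ _ _).1, appell_plane_odd hx, appell_plane_odd hy, Quaternion.star_smul,
      Quaternion.star_smul, smul_mul_smul_comm, smul_mul_smul_comm, plane_odd_product hx hy, hpow,
      smul_smul, additionConst, Nat.add_sub_cancel_left]
    congr 1
    ring

lemma sum_appell_plane {x y : R3} (hx : x 0 = 0) (hy : y 0 = 0) (k : ℕ) :
    ∑ l ∈ range (k + 1), additionConst k l • (appell k l x * star (appell k l y)) =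
      zonal k x y := by
  rw [zonal, qConv, Finset.Nat.sum_antidiagonal_eq_sum_range_succ (fun i j =>
    (binCoeff (1 / 2) i * binCoeff (3 / 2) j) •
      ((toQbar x * toQ y) ^ i * star (toQbar x * toQ y) ^ j)) k]
  refine Finset.sum_nbij' (fun l => if Even (k - l) then (k - l) / 2 else k - (k - l) / 2)
    (fun i => if 2 * i ≤ k then k - 2 * i else 2 * i - k - 1) ?_ ?_ ?_ ?_ ?_
  · intro l hl
    simp only [Finset.mem_range] at hl ⊢
    split_ifs <;> omega
  · intro i hi
    simp only [Finset.mem_range] at hi ⊢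
    split_ifs <;> omega
  · intro l hl
    simp only [Finset.mem_range, Nat.even_iff] at hl ⊢
    split_ifs <;> omega
  · intro i hi
    simp only [Finset.mem_range, Nat.even_iff] at hi ⊢
    split_ifs <;> omega
  · intro l hl
    exact appell_mul_star_plane hx hy (Nat.lt_succ_iff.1 (Finset.mem_range.1 hl))

lemma sum_appell_eq_zonal_of_left {y : R3} (k : ℕ)
    (h : ∀ x : R3, x 0 = 0 →
      ∑ l ∈ range (k + 1), additionConst k l • (appell k l x * star (appell k l y)) = zonal k x y)
    (x : R3) :
    ∑ l ∈ range (k + 1), additionConst k l • (appell k l x * star (appell k l y)) = zonal k x y := by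
  rw [← sub_eq_zero]
  have hA : ∀ l, ContDiff ℝ ∞ (fun x => additionConst k l • (appell k l x * star (appell k l y))) :=
    fun l => ((contDiff_appell k l).mul contDiff_const).const_smul _
  have hA' : ∀ l x, DifferentiableAt ℝ
      (fun x => additionConst k l • (appell k l x * star (appell k l y))) x :=
    fun l x => (hA l).differentiable (by simp) x
  have hAd : ∀ l x, DifferentiableAt ℝ (appell k l) x :=
    fun l x => (contDiff_appell k l (N := 1)).differentiable (by simp) x
  refine eq_zero_of_CRbar_of_plane k (P := fun x =>
    ∑ l ∈ range (k + 1), additionConst k l • (appell k l x * star (appell k l y)) - zonal k x y)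
    ?_ ?_ ?_ ?_ x
  · exact (ContDiff.sum fun l _ => hA l).sub (contDiff_zonal_left k y)
  · intro c _ x
    rw [zonal_smul_left, smul_sub, Finset.smul_sum]
    congr 1
    refine Finset.sum_congr rfl fun l hl => ?_
    rw [appell_smul (Nat.lt_succ_iff.1 (Finset.mem_range.1 hl)), smul_mul_assoc, smul_comm]
  · intro x
    have hz : DifferentiableAt ℝ (fun x => zonal k x y) x :=
      (contDiff_zonal_left k y (n := 1)).differentiable (by simp) x
    have hpd : ∀ i, pd i (fun x => ∑ l ∈ range (k + 1),
        additionConst k l • (appell k l x * star (appell k l y)) - zonal k x y) x =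
        ∑ l ∈ range (k + 1), additionConst k l • (pd i (appell k l) x * star (appell k l y))
          - pd i (fun x => zonal k x y) x := by
      intro i
      rw [pd_sub (DifferentiableAt.fun_sum fun l _ => hA' l x) hz, pd_sum _ fun l _ => hA' l x]
      congr 1
      refine Finset.sum_congr rfl fun l _ => ?_
      rw [pd_const_smul _ ((hAd l x).fun_mul (differentiableAt_const _)), pd_mul_const _ (hAd l x)]
    rw [CRbar_eq_sum]
    simp only [hpd, mul_sub, Finset.sum_sub_distrib, ← CRbar_eq_sum, CRbar_zonal, sub_zero,
      Finset.mul_sum]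
    rw [Finset.sum_comm]
    refine Finset.sum_eq_zero fun l _ => ?_
    have := CRbar_appell k l x
    rw [CRbar_eq_sum] at this
    simp only [mul_smul_comm, ← mul_assoc, ← Finset.smul_sum, ← Finset.sum_mul, this, zero_mul,
      smul_zero]
  · intro x hx
    rw [h x hx, sub_self]

/-- The addition theorem for the Appell polynomials. -/
theorem sum_appell_mul_star (k : ℕ) (x y : R3) :
    ∑ l ∈ range (k + 1), additionConst k l • (appell k l x * star (appell k l y)) =
      zonal k x y := by
  have hstar : ∀ x y : R3,
      star (∑ l ∈ range (k + 1), additionConst k l • (appell k l x * star (appell k l y))) =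
      ∑ l ∈ range (k + 1), additionConst k l • (appell k l y * star (appell k l x)) := by
    intro x y
    simp only [star_sum, Quaternion.star_smul, star_mul, star_star]
  refine sum_appell_eq_zonal_of_left k (fun x hx => ?_) x
  rw [← star_inj, hstar, star_zonal]
  exact sum_appell_eq_zonal_of_left k (fun y hy => sum_appell_plane hy hx k) y

lemma binCoeff_half_nonneg (n : ℕ) : 0 ≤ binCoeff (1 / 2) n := by
  induction n with
  | zero => simp [binCoeff]
  | succ n ih => rw [binCoeff]; positivity

lemma binCoeff_half_le (n : ℕ) : binCoeff (1 / 2) n ≤ 1 := by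
  induction n with
  | zero => simp [binCoeff]
  | succ n ih =>
    rw [binCoeff]
    refine mul_le_one₀ ih (by positivity) ?_
    rw [div_le_one (by positivity)]
    linarith

lemma binCoeff_three_halves_nonneg (n : ℕ) : 0 ≤ binCoeff (3 / 2) n := by
  induction n with
  | zero => simp [binCoeff]
  | succ n ih => rw [binCoeff]; positivity

lemma binCoeff_three_halves_le (n : ℕ) : binCoeff (3 / 2) n ≤ n + 1 := by
  induction n with
  | zero => simp [binCoeff]
  | succ n ih =>
    rw [binCoeff]
    have h : (3 / 2 + (n : ℝ)) / (n + 1) ≤ (n + 2) / (n + 1) := by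
      refine div_le_div_of_nonneg_right ?_ (by positivity)
      linarith
    calc _ ≤ ((n : ℝ) + 1) * ((n + 2) / (n + 1)) := by gcongr
      _ = _ := by push_cast; field_simp; ring

lemma binCoeff_three_halves_succ (n : ℕ) :
    binCoeff (3 / 2) (n + 1) - binCoeff (3 / 2) n = binCoeff (1 / 2) (n + 1) := by
  have := congrArg (PowerSeries.coeff (n + 1)) (binSeries_sub_one (3 / 2) (1 : ℝ))
  rw [sub_mul, one_mul, mul_assoc, map_sub, PowerSeries.coeff_C_mul,
    PowerSeries.coeff_succ_X_mul] at this
  simp only [binSeries, PowerSeries.coeff_mk, one_pow, smul_eq_mul, mul_one, one_mul] at this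
  rw [this]
  norm_num

lemma sum_binCoeff_half (n : ℕ) :
    ∑ ij ∈ antidiagonal n, binCoeff (1 / 2) ij.1 * binCoeff (1 / 2) ij.2 = 1 := by
  have h : binConv (1 / 2) (1 / 2) (1 : ℝ) 1 n = 1 := by
    induction n using Nat.twoStepInduction with
    | zero => simp [binConv_eq_sum, binCoeff]
    | one =>
      rw [binConv_eq_sum, Finset.Nat.antidiagonal_succ]
      simp [binCoeff]
      norm_num
    | more n ih1 ih2 =>
      have := binConv_recurrence (1 / 2) (1 : ℝ) 1 n
      rw [ih1, ih2] at this
      simp only [smul_eq_mul] at this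
      have h2 : (n : ℝ) + 2 ≠ 0 := by positivity
      refine mul_left_cancel₀ h2 ?_
      linarith
  rw [binConv_eq_sum] at h
  simpa using h

lemma norm_qConv_le (w : QH) (k : ℕ) :
    ‖qConv (1 / 2) (3 / 2) w k‖ ≤ ((k : ℝ) + 1) ^ 2 * ‖w‖ ^ k := by
  rw [qConv]
  calc _ ≤ ∑ ij ∈ antidiagonal k, ((k : ℝ) + 1) * ‖w‖ ^ k := by
        refine norm_sum_le_of_le _ fun ij hij => ?_
        rw [HasAntidiagonal.mem_antidiagonal] at hij
        rw [norm_smul, norm_mul (w ^ _), norm_pow, norm_pow, norm_star, ← pow_add, hij, norm_mul,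
          Real.norm_of_nonneg (binCoeff_half_nonneg _),
          Real.norm_of_nonneg (binCoeff_three_halves_nonneg _)]
        have h1 := binCoeff_half_le ij.1
        have h2 := binCoeff_three_halves_le ij.2
        have h3 := binCoeff_three_halves_nonneg ij.2
        have h4 : (ij.2 : ℝ) ≤ k := by exact_mod_cast (by omega)
        gcongr
        nlinarith
    _ = _ := by
        rw [Finset.sum_const, Finset.Nat.card_antidiagonal, nsmul_eq_mul]
        push_cast
        ring

lemma summable_sq_mul_pow {t : ℝ} (h0 : 0 ≤ t) (ht : t < 1) :
    Summable fun k : ℕ => ((k : ℝ) + 1) ^ 2 * t ^ k := by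
  have h : ‖t‖ < 1 := by rwa [Real.norm_of_nonneg h0]
  have h2 := summable_pow_mul_geometric_of_norm_lt_one 2 h
  have h1 := summable_pow_mul_geometric_of_norm_lt_one 1 h
  have h0 := summable_pow_mul_geometric_of_norm_lt_one 0 h
  refine ((h2.add (h1.mul_left 2)).add h0).congr fun k => ?_
  ring

lemma summable_norm_binCoeff_half {w : QH} (hw : ‖w‖ < 1) :
    Summable fun i : ℕ => ‖binCoeff (1 / 2) i • w ^ i‖ := by
  refine Summable.of_nonneg_of_le (fun _ => norm_nonneg _) (fun k => ?_)
    (summable_sq_mul_pow (norm_nonneg w) hw)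
  rw [norm_smul, norm_pow, Real.norm_of_nonneg (binCoeff_half_nonneg _)]
  have := binCoeff_half_le k
  gcongr
  have : (0 : ℝ) ≤ k := k.cast_nonneg
  nlinarith

lemma summable_norm_binCoeff_three_halves {w : QH} (hw : ‖w‖ < 1) :
    Summable fun i : ℕ => ‖binCoeff (3 / 2) i • w ^ i‖ := by
  refine Summable.of_nonneg_of_le (fun _ => norm_nonneg _) (fun k => ?_)
    (summable_sq_mul_pow (norm_nonneg w) hw)
  rw [norm_smul, norm_pow, Real.norm_of_nonneg (binCoeff_three_halves_nonneg _)]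
  have := binCoeff_three_halves_le k
  gcongr
  have : (0 : ℝ) ≤ k := k.cast_nonneg
  nlinarith

/-- The principal branch of `(1 - w)^{-1/2}`. -/
def invSqrt (w : QH) : QH := ∑' i : ℕ, binCoeff (1 / 2) i • w ^ i

lemma star_invSqrt (w : QH) : star (invSqrt w) = invSqrt (star w) := by
  rw [invSqrt, tsum_star, invSqrt]
  simp only [Quaternion.star_smul, star_pow]

lemma one_sub_mul_invSqrt_sq {w : QH} (hw : ‖w‖ < 1) : (1 - w) * (invSqrt w * invSqrt w) = 1 := by
  have h := summable_norm_binCoeff_half hw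
  have hsq : invSqrt w * invSqrt w = ∑' n : ℕ, w ^ n := by
    rw [invSqrt, tsum_mul_tsum_eq_tsum_sum_antidiagonal_of_summable_norm h h]
    refine tsum_congr fun n => ?_
    calc _ = ∑ ij ∈ antidiagonal n, (binCoeff (1 / 2) ij.1 * binCoeff (1 / 2) ij.2) • w ^ n := by
          refine Finset.sum_congr rfl fun ij hij => ?_
          rw [HasAntidiagonal.mem_antidiagonal] at hij
          rw [smul_mul_smul_comm, ← pow_add, hij]
      _ = _ := by rw [← Finset.sum_smul, sum_binCoeff_half, one_smul]
  rw [hsq]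
  exact mul_neg_geom_series w hw

lemma one_sub_mul_tsum_three_halves {w : QH} (hw : ‖w‖ < 1) :
    (1 - w) * ∑' i : ℕ, binCoeff (3 / 2) i • w ^ i = invSqrt w := by
  have h := (summable_norm_binCoeff_three_halves hw).of_norm
  have h' := (summable_norm_binCoeff_half hw).of_norm
  have hs : Summable fun i : ℕ => binCoeff (3 / 2) (i + 1) • w ^ (i + 1) :=
    (summable_nat_add_iff 1).2 h
  rw [sub_mul, one_mul, ← tsum_mul_left, h.tsum_eq_zero_add, add_sub_assoc,
    ← hs.tsum_sub (h.mul_left w), invSqrt, h'.tsum_eq_zero_add]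
  congr 1
  refine tsum_congr fun n => ?_
  rw [mul_smul_comm, ← pow_succ', ← sub_smul, binCoeff_three_halves_succ]

/-- The Cauchy kernel series in the variable `w`. -/
theorem hasSum_qConv {w : QH} (hw : ‖w‖ < 1) :
    HasSum (fun k => qConv (1 / 2) (3 / 2) w k) ((‖1 - w‖ ^ 3)⁻¹ • (1 - w)) := by
  have hw' : ‖star w‖ < 1 := by rwa [norm_star]
  have h1 := summable_norm_binCoeff_half hw
  have h2 := summable_norm_binCoeff_three_halves hw'
  have hq : ∀ k, qConv (1 / 2) (3 / 2) w k = ∑ ij ∈ antidiagonal k,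
      (binCoeff (1 / 2) ij.1 • w ^ ij.1) * (binCoeff (3 / 2) ij.2 • star w ^ ij.2) := by
    intro k
    simp only [qConv, smul_mul_smul_comm]
  have hs : Summable fun k => qConv (1 / 2) (3 / 2) w k :=
    (Summable.of_nonneg_of_le (fun _ => norm_nonneg _) (norm_qConv_le w)
      (summable_sq_mul_pow (norm_nonneg w) hw)).of_norm
  have ht := tsum_mul_tsum_eq_tsum_sum_antidiagonal_of_summable_norm h1 h2
  rw [← invSqrt, tsum_congr fun k => (hq k).symm] at ht
  refine hs.hasSum_iff.2 ?_
  set S := ∑' k, qConv (1 / 2) (3 / 2) w k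
  have hcomm : Commute (1 - star w) (invSqrt w) := by
    refine Commute.sub_left (Commute.one_left _) ?_
    exact Commute.tsum_right _ fun i => ((commute_quaternion_star w).symm.pow_right i).smul_right _
  have hS : (1 - star w) * S = (‖invSqrt w‖ ^ 2) • (1 : QH) := by
    rw [← ht, ← mul_assoc, hcomm.eq, mul_assoc, one_sub_mul_tsum_three_halves hw', ← star_invSqrt,
      Quaternion.self_mul_star, Quaternion.normSq_eq_norm_mul_self, ← sq,
      ← Quaternion.coe_mul_eq_smul, mul_one]
  have hn : ‖1 - w‖ * ‖invSqrt w‖ ^ 2 = 1 := by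
    have := congrArg norm (one_sub_mul_invSqrt_sq hw)
    rwa [norm_mul, norm_mul, ← sq, norm_one] at this
  have h0 : ‖1 - w‖ ≠ 0 := left_ne_zero_of_mul_eq_one hn
  have h3 : (‖1 - w‖ ^ 2) • S = (‖invSqrt w‖ ^ 2) • (1 - w) := by
    have := congrArg ((1 - w) * ·) hS
    simp only [← mul_assoc, mul_smul_comm, mul_one] at this
    rw [← this, show (1 : QH) - star w = star (1 - w) by simp, Quaternion.self_mul_star,
      Quaternion.normSq_eq_norm_mul_self, ← sq, Quaternion.coe_mul_eq_smul]
  have h4 : S = (‖1 - w‖ ^ 2)⁻¹ • ((‖invSqrt w‖ ^ 2) • (1 - w)) := by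
    rw [← h3, smul_smul, inv_mul_cancel₀ (pow_ne_zero 2 h0), one_smul]
  rw [h4, smul_smul]
  congr 1
  have : ‖invSqrt w‖ ^ 2 = ‖1 - w‖⁻¹ := eq_inv_of_mul_eq_one_right hn
  rw [this]
  field_simp

/-- The Cauchy kernel (without normalisation). -/
def cauchyKernel (z : R3) : QH := (‖z‖ ^ 3)⁻¹ • toQbar z

/-- The degree `k` part of the Cauchy kernel, in the region `‖x‖ < ‖y‖`. -/
def kernelTerm (k : ℕ) (x y : R3) : QH := (‖y‖ ^ (2 * k + 3))⁻¹ • (zonal k x y * toQbar y)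

lemma norm_kernelTerm_le (k : ℕ) {x y : R3} (hy : y ≠ 0) :
    ‖kernelTerm k x y‖ ≤ (‖y‖ ^ 2)⁻¹ * (((k : ℝ) + 1) ^ 2 * (‖x‖ / ‖y‖) ^ k) := by
  have hy' : 0 < ‖y‖ := norm_pos_iff.2 hy
  rw [kernelTerm, norm_smul, norm_mul, norm_toQbar, zonal, norm_inv, norm_pow, norm_norm]
  have := norm_qConv_le (toQbar x * toQ y) k
  rw [norm_mul, norm_toQbar, norm_toQ] at this
  calc _ ≤ (‖y‖ ^ (2 * k + 3))⁻¹ * (((k : ℝ) + 1) ^ 2 * (‖x‖ * ‖y‖) ^ k * ‖y‖) := by gcongr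
    _ = _ := by
      rw [div_pow, mul_pow]
      field_simp
      ring

theorem hasSum_kernelTerm {x y : R3} (h : ‖x‖ < ‖y‖) :
    HasSum (fun k => kernelTerm k x y) (cauchyKernel (y - x)) := by
  have hy : 0 < ‖y‖ := (norm_nonneg x).trans_lt h
  set w : QH := (‖y‖ ^ 2)⁻¹ • (toQbar x * toQ y) with hw
  have hn : ‖w‖ < 1 := by
    rw [hw, norm_smul, norm_mul, norm_toQbar, norm_toQ, norm_inv, norm_pow, norm_norm]
    rw [inv_mul_lt_one₀ (by positivity), sq]
    gcongr
  have h1 : 1 - w = (‖y‖ ^ 2)⁻¹ • (toQbar (y - x) * toQ y) := by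
    rw [toQbar_sub, sub_mul, toQbar_mul_toQ, smul_sub, smul_smul,
      inv_mul_cancel₀ (by positivity), one_smul]
  have h2 := ((hasSum_qConv hn).mul_right (toQbar y)).const_smul (‖y‖ ^ 3)⁻¹
  have hxy : 0 < ‖y - x‖ := by
    rw [norm_pos_iff, sub_ne_zero]
    rintro rfl
    exact lt_irrefl _ h
  have h3 : ‖1 - w‖ = ‖y - x‖ / ‖y‖ := by
    rw [h1, norm_smul, norm_mul, norm_toQbar, norm_toQ, norm_inv, norm_pow, norm_norm]
    field_simp
  have e : cauchyKernel (y - x) = (‖y‖ ^ 3)⁻¹ • ((‖1 - w‖ ^ 3)⁻¹ • (1 - w) * toQbar y) := by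
    rw [h3, h1, smul_mul_assoc, smul_mul_assoc, mul_assoc, toQ_mul_toQbar, mul_smul_comm, mul_one,
      smul_smul, smul_smul, smul_smul, cauchyKernel]
    congr 1
    field_simp
  rw [e]
  refine h2.congr_fun ?_
  · intro k
    rw [hw, qConv_smul, smul_mul_assoc, smul_smul, kernelTerm, zonal]
    congr 1
    rw [← inv_pow, ← inv_pow, ← inv_pow]
    ring

lemma kelvin_appell {n l : ℕ} (h : l ≤ n) (x : R3) :
    kelvin (appell n l) x = (‖x‖ ^ (2 * n + 3))⁻¹ • (toQbar x * appell n l (barPt x)) := by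
  rw [kelvin, appell_smul h, smul_mul_smul_comm]
  congr 1
  rw [← inv_pow, ← inv_pow, ← inv_pow]
  ring

lemma sum_appell_mul_outerAppell (n : ℕ) (x y : R3) :
    ∑ l ∈ range (n + 1), (((n : ℝ) + 1) / 4 ^ l) •
      (appell n l x * star (outerAppell n l (barPt y))) = kernelTerm n x y := by
  rw [kernelTerm, ← sum_appell_mul_star, Finset.sum_mul, Finset.smul_sum]
  refine Finset.sum_congr rfl fun l hl => ?_
  rw [outerAppell, kelvin_appell (Nat.lt_succ_iff.1 (Finset.mem_range.1 hl)), barPt_barPt,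
    norm_barPt, toQbar_barPt, Quaternion.star_smul, Quaternion.star_smul, star_mul, toQbar_eq_star,
    additionConst, smul_mul_assoc, mul_assoc, mul_smul_comm, mul_smul_comm, smul_smul, smul_smul,
    smul_smul]
  congr 1
  ring

lemma sum_outerAppell_mul_appell (n : ℕ) (x y : R3) :
    ∑ l ∈ range (n + 1), (((n : ℝ) + 1) / 4 ^ l) •
      (outerAppell n l x * star (appell n l (barPt y))) =
        star (kernelTerm n (barPt y) (barPt x)) := by
  rw [← sum_appell_mul_outerAppell, star_sum, barPt_barPt]
  simp only [Quaternion.star_smul, star_mul, star_star]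

lemma star_cauchyKernel_barPt (x y : R3) :
    star (cauchyKernel (barPt x - barPt y)) = cauchyKernel (x - y) := by
  have : barPt x - barPt y = barPt (x - y) := (barL.map_sub x y).symm
  rw [this, cauchyKernel, cauchyKernel, norm_barPt, Quaternion.star_smul, toQbar_barPt,
    toQbar_eq_star]

theorem hasSum_star_kernelTerm {x y : R3} (h : ‖y‖ < ‖x‖) :
    HasSum (fun k => star (kernelTerm k (barPt y) (barPt x))) (cauchyKernel (x - y)) := by
  rw [← star_cauchyKernel_barPt]
  exact (hasSum_kernelTerm (by rwa [norm_barPt, norm_barPt])).star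

/-- The Cauchy-Riemann operator acting from the right. -/
def rightCR (f : R3 → QH) (x : R3) : QH := ∑ i, pd i f x * eB i

lemma hasDerivAt_point_line (x : R3) (i : Fin 3) :
    HasDerivAt (fun t : ℝ => x + t • (EuclideanSpace.single i 1 : R3)) (EuclideanSpace.single i 1) 0 := by
  simpa using ((hasDerivAt_id (0 : ℝ)).smul_const (EuclideanSpace.single i 1 : R3)).const_add x

lemma hasDerivAt_norm_sq_line (x : R3) (i : Fin 3) :
    HasDerivAt (fun t : ℝ => ‖x + t • (EuclideanSpace.single i 1 : R3)‖ ^ 2) (2 * x i) 0 := by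
  refine (hasDerivAt_point_line x i).norm_sq.congr_deriv ?_
  simp [EuclideanSpace.inner_single_right]

lemma hasDerivAt_norm_line {x : R3} (hx : x ≠ 0) (i : Fin 3) :
    HasDerivAt (fun t : ℝ => ‖x + t • (EuclideanSpace.single i 1 : R3)‖) (x i / ‖x‖) 0 := by
  have h := (hasDerivAt_norm_sq_line x i).sqrt (by simpa using hx)
  simp only [zero_smul, add_zero, Real.sqrt_sq (norm_nonneg _)] at h
  refine h.congr_deriv ?_
  rw [mul_div_mul_left _ _ two_ne_zero]

lemma hasDerivAt_toQbar_line (x : R3) (i : Fin 3) :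
    HasDerivAt (fun t : ℝ => toQbar (x + t • (EuclideanSpace.single i 1 : R3))) (star (eB i)) 0 := by
  simp only [toQbar_add, toQbar_smul, toQbar_eq_star (EuclideanSpace.single i 1), toQ_single]
  simpa using ((hasDerivAt_id (0 : ℝ)).smul_const (star (eB i))).const_add (toQbar x)

lemma fderiv_eq_sum_pd (P : R3 → QH) (z u : R3) : fderiv ℝ P z u = ∑ j, u j • pd j P z := by
  conv_lhs => rw [show u = ∑ j, u j • (EuclideanSpace.single j 1 : R3) by
    ext k; simp [EuclideanSpace.single, Fin.sum_univ_three]; fin_cases k <;> simp]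
  rw [map_sum]
  simp only [map_smul]
  rfl

lemma contDiffAt_kelvin {P : R3 → QH} (hP : ContDiff ℝ 1 P) {x : R3} (hx : x ≠ 0) :
    ContDiffAt ℝ 1 (kelvin P) x := by
  have h : ‖x‖ ≠ 0 := norm_ne_zero_iff.2 hx
  have hn : ContDiffAt ℝ 1 (fun x : R3 => ‖x‖) x := contDiffAt_norm ℝ hx
  have h3 := (hn.pow 3).inv (pow_ne_zero 3 h)
  have h2 := (hn.pow 2).inv (pow_ne_zero 2 h)
  exact (h3.smul contDiff_toQbar.contDiffAt).mul
    (hP.contDiffAt.comp x (h2.smul contDiff_barPt.contDiffAt))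

theorem CRbar_kelvin {P : R3 → QH} (hP : ContDiff ℝ 1 P) (hCR : ∀ z, CRbar P z = 0) {x : R3}
    (hx : x ≠ 0) : CRbar (kelvin P) x = 0 := by
  have h : ‖x‖ ≠ 0 := norm_ne_zero_iff.2 hx
  set v : R3 := (‖x‖ ^ 2)⁻¹ • barPt x with hv
  set u : Fin 3 → R3 := fun i =>
    (‖x‖ ^ 2)⁻¹ • barPt (EuclideanSpace.single i 1 - (2 * x i * (‖x‖ ^ 2)⁻¹) • x) with hu
  have hpd : ∀ i, pd i (kelvin P) x =
      ((‖x‖ ^ 3)⁻¹ • star (eB i) - (3 * x i * (‖x‖ ^ 5)⁻¹) • toQbar x) * P v +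
      (‖x‖ ^ 3)⁻¹ • (toQbar x * ∑ j, u i j • pd j P v) := by
    intro i
    refine pd_eq_of_hasDerivAt ((contDiffAt_kelvin hP hx).differentiableAt (by simp)) ?_
    have hn := hasDerivAt_norm_line hx i
    have h3 := (hn.fun_pow 3).fun_inv (by simpa using h)
    have h2 := (hasDerivAt_norm_sq_line x i).fun_inv (by simpa using h)
    have hE := h3.fun_smul (hasDerivAt_toQbar_line x i)
    have hb : HasDerivAt (fun t : ℝ => barPt (x + t • (EuclideanSpace.single i 1 : R3)))
        (barPt (EuclideanSpace.single i 1)) 0 :=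
      (LinearMap.toContinuousLinearMap barL).hasFDerivAt.comp_hasDerivAt 0
        (hasDerivAt_point_line x i)
    have hvl := h2.fun_smul hb
    have hPl := (hP.differentiable (by simp) ((‖x + (0 : ℝ) • (EuclideanSpace.single i 1 : R3)‖ ^ 2)⁻¹ •
      barPt (x + (0 : ℝ) • (EuclideanSpace.single i 1 : R3)))).hasFDerivAt.comp_hasDerivAt 0 hvl
    have := hE.fun_mul hPl
    simp only [zero_smul, add_zero] at this
    refine this.congr_deriv ?_
    have eE : (‖x‖ ^ 3)⁻¹ • star (eB i) +
        (-(((3 : ℕ) : ℝ) * ‖x‖ ^ (3 - 1) * (x i / ‖x‖)) / (‖x‖ ^ 3) ^ 2) • toQbar x =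
        (‖x‖ ^ 3)⁻¹ • star (eB i) - (3 * x i * (‖x‖ ^ 5)⁻¹) • toQbar x := by
      rw [sub_eq_add_neg, ← neg_smul]
      congr 2
      field_simp
      norm_num
      ring
    have eu : (‖x‖ ^ 2)⁻¹ • barPt (EuclideanSpace.single i 1) +
        (-(2 * x i) / (‖x‖ ^ 2) ^ 2) • barPt x = u i := by
      have hb : barPt (EuclideanSpace.single i 1 - (2 * x i * (‖x‖ ^ 2)⁻¹) • x) =
          barPt (EuclideanSpace.single i 1) - (2 * x i * (‖x‖ ^ 2)⁻¹) • barPt x := by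
        exact (barL.map_sub _ _).trans (congrArg _ (barL.map_smul _ _))
      rw [hu]
      simp only [hb, smul_sub, smul_smul]
      rw [sub_eq_add_neg, ← neg_smul]
      congr 2
      field_simp
    rw [eE, eu, Function.comp_apply, zero_smul, add_zero, ← hv, smul_mul_assoc, fderiv_eq_sum_pd]
  have h1 : ∑ i, eB i * ((‖x‖ ^ 3)⁻¹ • star (eB i) - (3 * x i * (‖x‖ ^ 5)⁻¹) • toQbar x) = 0 := by
    have e1 : ∑ i, eB i * star (eB i) = (3 : ℝ) • (1 : QH) := by
      rw [Fin.sum_univ_three]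
      ext <;> simp [eB]
      norm_num
    have e2 : ∑ i, x i • eB i = toQ x := by
      rw [Fin.sum_univ_three]
      ext <;> simp [eB]
    calc _ = (‖x‖ ^ 3)⁻¹ • ∑ i, eB i * star (eB i)
        - (3 * (‖x‖ ^ 5)⁻¹) • ((∑ i, x i • eB i) * toQbar x) := by
          rw [Finset.sum_mul, Finset.smul_sum, Finset.smul_sum, ← Finset.sum_sub_distrib]
          refine Finset.sum_congr rfl fun i _ => ?_
          rw [mul_sub, mul_smul_comm, mul_smul_comm, smul_mul_assoc, smul_smul]
          congr 2
          ring
      _ = 0 := by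
          rw [e1, e2, toQ_mul_toQbar, smul_smul, smul_smul, ← sub_smul]
          convert zero_smul ℝ (1 : QH)
          field_simp
          ring
  have h2 : ∀ j, ∑ i, u i j • (eB i * toQbar x) = -((‖x‖ ^ 2)⁻¹ • (toQ x * eB j)) := by
    intro j
    set s : Fin 3 → ℝ := ![1, -1, -1] with hs
    have hsum : ∑ i, u i j • eB i =
        ((‖x‖ ^ 2)⁻¹ * s j) • (eB j - (2 * x j * (‖x‖ ^ 2)⁻¹) • toQ x) := by
      rw [Fin.sum_univ_three, hu]
      generalize (‖x‖ ^ 2)⁻¹ = r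
      fin_cases j <;> ext <;>
        simp [eB, hs, -mul_eq_mul_left_iff, -mul_eq_mul_right_iff] <;> ring
    have hj : s j • (eB j * toQbar x - (2 * x j) • (1 : QH)) = -(toQ x * eB j) := by
      fin_cases j <;> ext <;> simp [eB, hs] <;> ring
    calc _ = (∑ i, u i j • eB i) * toQbar x := by
          rw [Finset.sum_mul]
          simp only [smul_mul_assoc]
      _ = (‖x‖ ^ 2)⁻¹ • (s j • (eB j * toQbar x - (2 * x j) • (1 : QH))) := by
          have hxj : 2 * x j * (‖x‖ ^ 2)⁻¹ * ‖x‖ ^ 2 = 2 * x j := by field_simp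
          rw [hsum, smul_mul_assoc, sub_mul, smul_mul_assoc, toQ_mul_toQbar, smul_smul, hxj,
            mul_smul]
      _ = _ := by rw [hj, smul_neg]
  rw [CRbar_eq_sum]
  simp only [hpd, mul_add, Finset.sum_add_distrib, ← mul_assoc, ← Finset.sum_mul, h1, zero_mul,
    zero_add, mul_smul_comm, ← Finset.smul_sum]
  have h3 : ∑ i, eB i * toQbar x * ∑ j, u i j • pd j P v = 
      -((‖x‖ ^ 2)⁻¹ • (toQ x * CRbar P v)) := by
    simp only [Finset.mul_sum, mul_smul_comm]
    rw [Finset.sum_comm, CRbar_eq_sum, Finset.mul_sum, Finset.smul_sum, ← Finset.sum_neg_distrib]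
    refine Finset.sum_congr rfl fun j _ => ?_
    rw [← mul_assoc, ← smul_mul_assoc, ← neg_mul, ← h2, Finset.sum_mul]
    simp only [smul_mul_assoc]
  rw [h3, hCR, mul_zero, smul_zero, neg_zero, smul_zero]

lemma rightCR_star_barPt {g : R3 → QH} {y : R3} (hg : DifferentiableAt ℝ g (barPt y))
    (hCR : CRbar g (barPt y) = 0) : rightCR (fun y => star (g (barPt y))) y = 0 := by
  have hpd : ∀ i, pd i (fun y => star (g (barPt y))) y =
      star (fderiv ℝ g (barPt y) (barPt (EuclideanSpace.single i 1))) := by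
    intro i
    have hb := (LinearMap.toContinuousLinearMap barL).hasFDerivAt (x := y)
    have h1 := (hg.hasFDerivAt).comp y hb
    have h2 := (LinearMap.toContinuousLinearMap (𝕜 := ℝ)
      { toFun := (star : QH → QH), map_add' := star_add, map_smul' := Quaternion.star_smul }
      ).hasFDerivAt.comp y h1
    simp only [pd]
    rw [show fderiv ℝ (fun y => star (g (barPt y))) y = _ from h2.fderiv]
    rfl
  rw [rightCR, ← star_inj, star_sum, star_zero, ← hCR, CRbar_eq_sum]
  refine Finset.sum_congr rfl fun i _ => ?_
  rw [hpd, star_mul, star_star, fderiv_eq_sum_pd, Fin.sum_univ_three]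
  fin_cases i <;> ext <;> simp [eB]

lemma CRbar_outerAppell (n l : ℕ) {x : R3} (hx : x ≠ 0) : CRbar (outerAppell n l) x = 0 := by
  have := CRbar_kelvin (contDiff_appell n l) (CRbar_appell n l) hx
  have hd := (contDiffAt_kelvin (contDiff_appell n l) hx).differentiableAt (by simp)
  refine (CRbar_const_smul _ hd).trans ?_
  rw [this, smul_zero]

lemma contDiffAt_outerAppell (n l : ℕ) {x : R3} (hx : x ≠ 0) :
    ContDiffAt ℝ 1 (outerAppell n l) x :=
  (contDiffAt_kelvin (contDiff_appell n l) hx).const_smul _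

lemma psiFam_eq (k : ℤ) (l : ℕ) :
    psiFam k l = if 0 ≤ k then appell k.toNat l else outerAppell (-k - 2).toNat l := by
  funext x
  rw [psiFam]
  split_ifs <;> rfl

lemma contDiffAt_psiFam (k : ℤ) (l : ℕ) {x : R3} (hx : x ≠ 0) : ContDiffAt ℝ 1 (psiFam k l) x := by
  rw [psiFam_eq]
  split_ifs
  · exact (contDiff_appell _ _).contDiffAt
  · exact contDiffAt_outerAppell _ _ hx

lemma CRbar_psiFam (k : ℤ) (l : ℕ) {x : R3} (hx : x ≠ 0) : CRbar (psiFam k l) x = 0 := by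
  rw [psiFam_eq]
  split_ifs
  · exact CRbar_appell _ _ _
  · exact CRbar_outerAppell _ _ hx

lemma barPt_ne_zero {y : R3} (hy : y ≠ 0) : barPt y ≠ 0 := by
  rwa [← norm_ne_zero_iff, norm_barPt, norm_ne_zero_iff]

/-- The integration weights of the Laurent coefficients are monogenic from the right. -/
theorem rightCR_star_psiFam (k : ℤ) (l : ℕ) {y : R3} (hy : y ≠ 0) :
    rightCR (fun y => star (psiFam k l (barPt y))) y = 0 :=
  rightCR_star_barPt ((contDiffAt_psiFam k l (barPt_ne_zero hy)).differentiableAt (by simp))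
    (CRbar_psiFam k l (barPt_ne_zero hy))

lemma contDiffAt_star_psiFam (k : ℤ) (l : ℕ) {y : R3} (hy : y ≠ 0) :
    ContDiffAt ℝ 1 (fun y => star (psiFam k l (barPt y))) y :=
  contDiff_quaternion_star.contDiffAt.comp y
    ((contDiffAt_psiFam k l (barPt_ne_zero hy)).comp y contDiff_barPt.contDiffAt)

lemma contDiff_of_tsupport_subset {F : Type*} [NormedAddCommGroup F] [NormedSpace ℝ F]
    {h : R3 → F} {U : Set R3} (hU : ∀ x ∈ U, ContDiffAt ℝ 1 h x) (hs : tsupport h ⊆ U) :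
    ContDiff ℝ 1 h := by
  rw [contDiff_iff_contDiffAt]
  intro x
  by_cases hx : x ∈ tsupport h
  · exact hU x (hs hx)
  · exact (contDiffAt_const (c := (0 : F))).congr_of_eventuallyEq
      (notMem_tsupport_iff_eventuallyEq.1 hx)

lemma integrable_pd {h : R3 → QH} (hh : ContDiff ℝ 1 h) (hc : HasCompactSupport h) (i : Fin 3) :
    Integrable (pd i h) :=
  ((hh.continuous_fderiv (by simp)).clm_apply continuous_const).integrable_of_hasCompactSupport
    ((hc.fderiv (𝕜 := ℝ)).comp_left (g := fun L : R3 →L[ℝ] QH => L (EuclideanSpace.single i 1)) rfl)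

lemma integral_pd_eq_zero {h : R3 → QH} (hh : ContDiff ℝ 1 h) (hc : HasCompactSupport h)
    (i : Fin 3) : ∫ y, pd i h y = 0 := by
  have := integral_smul_fderiv_eq_neg_fderiv_smul_of_integrable (𝕜 := ℝ) (μ := (volume : Measure R3))
    (f := fun _ : R3 => (1 : ℝ)) (g := h) (v := EuclideanSpace.single i 1)
    (by simp) (by simpa [pd] using! integrable_pd hh hc i)
    (by simpa using hh.continuous.integrable_of_hasCompactSupport hc)
    (fun x _ => differentiableAt_const _) (fun x _ => hh.differentiable (by simp) x)
  simpa [pd] using this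

/-- Stokes' formula for a right-monogenic and a left-monogenic function, with a cut-off. -/
theorem integral_fderiv_cutoff_eq_zero {U : Set R3} {φ f : R3 → QH} {χ : R3 → ℝ}
    (hφ : ∀ y ∈ U, ContDiffAt ℝ 1 φ y) (hf : ∀ y ∈ U, ContDiffAt ℝ 1 f y)
    (hφR : ∀ y ∈ U, rightCR φ y = 0) (hfL : ∀ y ∈ U, CRbar f y = 0)
    (hχ : ContDiff ℝ 1 χ) (hc : HasCompactSupport χ) (hs : tsupport χ ⊆ U) :
    ∫ y, ∑ i, fderiv ℝ χ y (EuclideanSpace.single i 1) • (φ y * (eB i * f y)) = 0 := by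
  have hsub : ∀ i, tsupport (fun y => χ y • (φ y * (eB i * f y))) ⊆ tsupport χ :=
    fun i => closure_mono fun y hy hy0 => hy (by simp only [hy0, zero_smul])
  have hh : ∀ i, ContDiff ℝ 1 (fun y => χ y • (φ y * (eB i * f y))) := fun i =>
    contDiff_of_tsupport_subset (fun y hy =>
      hχ.contDiffAt.smul ((hφ y hy).mul (contDiffAt_const.mul (hf y hy)))) ((hsub i).trans hs)
  have hci : ∀ i, HasCompactSupport (fun y => χ y • (φ y * (eB i * f y))) := fun i => hc.smul_right
  calc _ = ∫ y, ∑ i, pd i (fun y => χ y • (φ y * (eB i * f y))) y := by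
        congr 1 with y : 1
        by_cases hy : y ∈ tsupport χ
        · have hyU := hs hy
          have hpd : ∀ i, pd i (fun y => χ y • (φ y * (eB i * f y))) y =
              χ y • (pd i φ y * eB i * f y) + χ y • (φ y * (eB i * pd i f y)) +
                fderiv ℝ χ y (EuclideanSpace.single i 1) • (φ y * (eB i * f y)) := by
            intro i
            have h1 := (hχ.differentiable (by simp) y).hasFDerivAt
            have h2 := ((hφ y hyU).differentiableAt (by simp)).hasFDerivAt
            have h3 := ((hf y hyU).differentiableAt (by simp)).hasFDerivAt
            have h4 : HasFDerivAt (fun y => χ y • (φ y * (eB i * f y))) _ y :=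
              h1.fun_smul (h2.mul' (h3.const_mul (eB i)))
            rw [pd, h4.fderiv]
            simp [pd, mul_assoc, add_comm]
          simp only [hpd, Finset.sum_add_distrib, ← Finset.smul_sum, ← Finset.mul_sum,
            ← Finset.sum_mul]
          have e1 : ∑ i, pd i φ y * eB i = 0 := hφR y hyU
          have e2 : ∑ i, eB i * pd i f y = 0 := by rw [← CRbar_eq_sum, hfL y hyU]
          simp [e1, e2]
        · have h0 := notMem_tsupport_iff_eventuallyEq.1 hy
          refine Finset.sum_congr rfl fun i _ => ?_
          have h1 := notMem_tsupport_iff_eventuallyEq.1 (fun h => hy (hsub i h))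
          rw [pd, h0.fderiv_eq, h1.fderiv_eq]
          simp
    _ = 0 := by
        rw [integral_finsetSum _ fun i _ => integrable_pd (hh i) (hci i) i]
        simp only [integral_pd_eq_zero (hh _) (hci _), Finset.sum_const_zero]

lemma contDiff_comp_norm {g : ℝ → ℝ} (hg : ContDiff ℝ 1 g) {c : ℝ}
    (h0 : g =ᶠ[nhds 0] fun _ => c) : ContDiff ℝ 1 (fun y : R3 => g ‖y‖) := by
  rw [contDiff_iff_contDiffAt]
  intro y
  rcases eq_or_ne y 0 with rfl | hy
  · refine (contDiffAt_const (c := c)).congr_of_eventuallyEq ?_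
    have : Filter.Tendsto (fun y : R3 => ‖y‖) (nhds 0) (nhds 0) := by
      simpa using (continuous_norm (E := R3)).tendsto 0
    exact this.eventually h0
  · exact hg.contDiffAt.comp y (contDiffAt_norm ℝ hy)

lemma fderiv_comp_norm {g : ℝ → ℝ} (hg : ContDiff ℝ 1 g) {c : ℝ}
    (h0 : g =ᶠ[nhds 0] fun _ => c) (y : R3) (i : Fin 3) :
    fderiv ℝ (fun y : R3 => g ‖y‖) y (EuclideanSpace.single i 1) =
      deriv g ‖y‖ * (‖y‖⁻¹ * y i) := by
  rcases eq_or_ne y 0 with rfl | hy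
  · have : Filter.Tendsto (fun y : R3 => ‖y‖) (nhds 0) (nhds 0) := by
      simpa using (continuous_norm (E := R3)).tendsto 0
    have h := this.eventually h0
    rw [Filter.EventuallyEq.fderiv_eq (f := fun _ => c) h]
    simp
  · have h1 := (((contDiff_comp_norm hg h0).differentiable (by simp)
      (y + (0 : ℝ) • EuclideanSpace.single i 1)).hasFDerivAt).comp_hasDerivAt 0
        (hasDerivAt_point_line y i)
    have h2 := ((hg.differentiable (by simp)
      ‖y + (0 : ℝ) • (EuclideanSpace.single i 1 : R3)‖).hasDerivAt).comp 0
        (hasDerivAt_norm_line hy i)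
    have := h1.unique h2
    simp only [zero_smul, add_zero] at this
    rw [this, div_eq_inv_mul]

lemma sum_smul_eB (y : R3) : ∑ i, y i • eB i = toQ y := by
  rw [Fin.sum_univ_three]
  ext <;> simp [eB]

lemma sum_fderiv_comp_norm_smul {g : ℝ → ℝ} (hg : ContDiff ℝ 1 g) {c : ℝ}
    (h0 : g =ᶠ[nhds 0] fun _ => c) (y : R3) (a b : QH) :
    ∑ i, fderiv ℝ (fun y : R3 => g ‖y‖) y (EuclideanSpace.single i 1) • (a * (eB i * b)) =
      deriv g ‖y‖ • (a * ((‖y‖⁻¹ • toQ y) * b)) := by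
  simp only [fderiv_comp_norm hg h0, mul_smul, ← Finset.smul_sum, ← sum_smul_eB, Finset.sum_mul,
    Finset.mul_sum, smul_mul_assoc, mul_smul_comm]

/-- Integration in polar coordinates. -/
theorem integral_eq_integral_sphereIntegral {F : R3 → QH} (hF : Integrable F) :
    ∫ y, F y = ∫ r in Set.Ioi (0 : ℝ), sphereIntegral r F := by
  set G : sphere (0 : R3) 1 × Set.Ioi (0 : ℝ) → QH := fun p => F ((p.2 : ℝ) • (p.1 : R3)) with hG
  have hmp := (volume : Measure R3).measurePreserving_homeomorphUnitSphereProd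
  have hemb := (homeomorphUnitSphereProd R3).measurableEmbedding
  have hdim : Module.finrank ℝ R3 - 1 = 2 := by simp
  have hGx : ∀ x : ({0}ᶜ : Set R3), G (homeomorphUnitSphereProd R3 x) = F x := by
    intro x
    have hx : ‖(x : R3)‖ ≠ 0 := norm_ne_zero_iff.2 x.2
    simp [hG, smul_smul, mul_inv_cancel₀ hx]
  have hint : Integrable G ((volume : Measure R3).toSphere.prod (Measure.volumeIoiPow 2)) := by
    have := hmp.integrable_comp_emb hemb (g := G)
    rw [hdim] at this
    rw [← this, show G ∘ homeomorphUnitSphereProd R3 = F ∘ Subtype.val from funext hGx,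
      ← integrableOn_iff_comap_subtypeVal (measurableSet_singleton _).compl]
    exact hF.integrableOn
  calc ∫ y, F y = ∫ x : ({0}ᶜ : Set R3), F x ∂(volume.comap Subtype.val) := by
        rw [integral_subtype_comap (measurableSet_singleton _).compl fun x => F x,
          restrict_compl_singleton]
    _ = ∫ p, G p ∂((volume : Measure R3).toSphere.prod (Measure.volumeIoiPow 2)) := by
        have := hmp.integral_comp hemb G
        rw [hdim] at this
        rw [← this]
        simp only [hGx]
    _ = ∫ r : Set.Ioi (0 : ℝ), ∫ u, G (u, r) ∂(volume : Measure R3).toSphere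
          ∂(Measure.volumeIoiPow 2) := integral_prod_symm G hint
    _ = _ := by
        simp only [Measure.volumeIoiPow, ENNReal.ofReal]
        rw [integral_withDensity_eq_integral_smul,
          integral_subtype_comap measurableSet_Ioi fun a : ℝ =>
            Real.toNNReal (a ^ 2) • ∫ u : sphere (0 : R3) 1, F (a • (u : R3))
              ∂(volume : Measure R3).toSphere,
          setIntegral_congr_fun measurableSet_Ioi fun r _ => ?_]
        · rw [NNReal.smul_def, Real.coe_toNNReal _ (sq_nonneg _), sphereIntegral, integral_smul]
        · exact (measurable_subtype_coe.pow_const _).real_toNNReal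

lemma norm_smul_sphere {r : ℝ} (hr : 0 < r) (u : sphere (0 : R3) 1) : ‖r • (u : R3)‖ = r := by
  rw [norm_smul, norm_eq_of_mem_sphere, mul_one, Real.norm_of_nonneg hr.le]

lemma continuousOn_sphereIntegral {J : Set ℝ} (hJ : J ⊆ Set.Ioi 0) {G : R3 → QH}
    (hG : ContinuousOn G {y | ‖y‖ ∈ J}) : ContinuousOn (fun r => sphereIntegral r G) J := by
  refine continuousOn_integral_of_compact_support (k := Set.univ) isCompact_univ ?_ (by simp)
  refine (by fun_prop : Continuous fun p : ℝ × sphere (0 : R3) 1 => p.1 ^ 2).continuousOn.smul ?_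
  refine hG.comp (by fun_prop) fun p hp => ?_
  simpa [norm_smul_sphere (hJ hp.1)] using hp.1

lemma integrable_smul_of_tsupport_subset {X : Type*} [TopologicalSpace X] [MeasurableSpace X]
    [OpensMeasurableSpace X] {μ : Measure X} [IsFiniteMeasureOnCompacts μ] {U : Set X}
    (hU : IsOpen U) {G : X → QH} (hG : ContinuousOn G U) {w : X → ℝ} (hw : Continuous w)
    (hc : HasCompactSupport w) (hs : tsupport w ⊆ U) : Integrable (fun y => w y • G y) μ := by
  refine Continuous.integrable_of_hasCompactSupport ?_ hc.smul_right
  refine ContinuousOn.continuous_of_tsupport_subset (hw.continuousOn.smul hG) hU ?_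
  refine (closure_mono fun y hy => ?_).trans hs
  intro hy0
  exact hy (by simp only [hy0, zero_smul])

lemma isCompact_norm_preimage {K : Set ℝ} (hK : IsCompact K) : IsCompact {y : R3 | ‖y‖ ∈ K} := by
  obtain ⟨C, hC⟩ := hK.isBounded.exists_norm_le
  refine (isCompact_closedBall (0 : R3) C).of_isClosed_subset
    (hK.isClosed.preimage continuous_norm) fun y hy => ?_
  simpa using hC _ hy

lemma tsupport_comp_norm_subset (w : ℝ → ℝ) :
    tsupport (fun y : R3 => w ‖y‖) ⊆ {y | ‖y‖ ∈ tsupport w} :=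
  closure_minimal (fun _ hy => subset_tsupport w hy)
    ((isClosed_tsupport w).preimage continuous_norm)

lemma integrable_norm_smul {J : Set ℝ} (hJo : IsOpen J) {G : R3 → QH}
    (hG : ContinuousOn G {y | ‖y‖ ∈ J}) {w : ℝ → ℝ} (hw : Continuous w)
    (hc : HasCompactSupport w) (hs : tsupport w ⊆ J) : Integrable fun y => w ‖y‖ • G y :=
  integrable_smul_of_tsupport_subset (hJo.preimage continuous_norm) hG (hw.comp continuous_norm)
    (HasCompactSupport.intro (isCompact_norm_preimage hc.isCompact) fun _ hy =>
      image_eq_zero_of_notMem_tsupport hy)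
    ((tsupport_comp_norm_subset w).trans fun _ hy => hs hy)

/-- The integral of a function with a radial factor, in polar coordinates. -/
lemma integral_norm_smul {J : Set ℝ} (hJo : IsOpen J) (hJ : J ⊆ Set.Ioi 0) {G : R3 → QH}
    (hG : ContinuousOn G {y | ‖y‖ ∈ J}) {w : ℝ → ℝ} (hw : Continuous w)
    (hc : HasCompactSupport w) (hs : tsupport w ⊆ J) :
    ∫ y, w ‖y‖ • G y = ∫ r, w r • sphereIntegral r G := by
  rw [integral_eq_integral_sphereIntegral (integrable_norm_smul hJo hG hw hc hs),
    ← setIntegral_eq_integral_of_forall_compl_eq_zero (s := Set.Ioi 0)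
      (f := fun r => w r • sphereIntegral r G)]
  · refine setIntegral_congr_fun measurableSet_Ioi fun r hr => ?_
    simp only [sphereIntegral, norm_smul_sphere hr, smul_comm _ (w r)]
    rw [integral_smul]
  · intro r hr
    rw [image_eq_zero_of_notMem_tsupport fun h => hr (hJ (hs h)), zero_smul]

/-- The du Bois-Reymond lemma for continuous functions on an open interval. -/
theorem eq_of_integral_deriv_smul_eq_zero {J : Set ℝ} (hJo : IsOpen J) (hJ : J.OrdConnected)
    {I : ℝ → QH} (hI : ContinuousOn I J)
    (h : ∀ g : ℝ → ℝ, ContDiff ℝ 1 g → HasCompactSupport g → tsupport g ⊆ J →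
      ∫ r, deriv g r • I r = 0) {a b : ℝ} (ha : a ∈ J) (hb : b ∈ J) : I a = I b := by
  obtain ⟨δ, hδ, hδJ⟩ := Metric.nhds_basis_closedBall.mem_iff.1 (hJo.mem_nhds ha)
  let B : ContDiffBump a := ⟨δ / 2, δ, half_pos hδ, half_lt_self hδ⟩
  set η : ℝ → ℝ := B.normed volume with hη
  have hηc : ContDiff ℝ 1 η := B.contDiff_normed (n := 1)
  have hηt : tsupport η = closedBall a δ := B.tsupport_normed_eq
  have hηi : ∫ t, η t = 1 := B.integral_normed
  have hηcs : HasCompactSupport η := B.hasCompactSupport_normed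
  set c := ∫ r, η r • I r with hcdef
  have key : ∀ g : ℝ → ℝ, ContDiff ℝ ∞ g → HasCompactSupport g → tsupport g ⊆ J →
      ∫ r, g r • (I r - c) = 0 := by
    intro g hg hgc hgs
    set m := ∫ t, g t with hm
    set k : ℝ → ℝ := fun t => g t - m * η t with hk
    have hkc : Continuous k := hg.continuous.sub (continuous_const.mul hηc.continuous)
    set K := tsupport g ∪ closedBall a δ with hK
    have hKc : IsCompact K := hgc.isCompact.union (isCompact_closedBall _ _)
    have hKJ : K ⊆ J := Set.union_subset hgs hδJ
    have hKn : K.Nonempty := ⟨a, Or.inr (mem_closedBall_self hδ.le)⟩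
    have hk0 : ∀ t ∉ K, k t = 0 := by
      intro t ht
      have h1 : g t = 0 := image_eq_zero_of_notMem_tsupport fun h => ht (Or.inl h)
      have h2 : η t = 0 := image_eq_zero_of_notMem_tsupport fun h => ht (Or.inr (hηt ▸ h))
      simp [hk, h1, h2]
    have hgi : Integrable g := hg.continuous.integrable_of_hasCompactSupport hgc
    have hηint : Integrable η := hηc.continuous.integrable_of_hasCompactSupport hηcs
    have hki : ∫ t, k t = 0 := by
      simp only [hk]
      rw [integral_sub hgi (hηint.const_mul m), integral_const_mul, hηi, ← hm, mul_one, sub_self]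
    set p := sInf K
    set q := sSup K
    have hp : p ∈ K := hKc.sInf_mem hKn
    have hq : q ∈ K := hKc.sSup_mem hKn
    have hKpq : K ⊆ Set.Icc p q := fun t ht =>
      ⟨csInf_le hKc.bddBelow ht, le_csSup hKc.bddAbove ht⟩
    set χ : ℝ → ℝ := fun t => ∫ s in (p - 1)..t, k s with hχ
    have hχd : deriv χ = k := funext fun t => hkc.deriv_integral _ _ _
    have hχ1 : ContDiff ℝ 1 χ := by
      rw [contDiff_one_iff_deriv, hχd]
      exact ⟨fun t => (hkc.integral_hasStrictDerivAt _ _).hasDerivAt.differentiableAt, hkc⟩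
    have hχ0 : ∀ t ∉ Set.Icc p q, χ t = 0 := by
      intro t ht
      rcases lt_or_ge t p with htp | htp
      · simp only [hχ]
        rw [intervalIntegral.integral_congr (g := fun _ => (0 : ℝ)), intervalIntegral.integral_zero]
        intro s hs
        refine hk0 s fun hsK => ?_
        have h1 := (hKpq hsK).1
        have h2 := hs.2
        have : max (p - 1) t < p := max_lt (by linarith) htp
        linarith
      · have hqt : q < t := lt_of_not_ge fun h => ht ⟨htp, h⟩
        simp only [hχ]
        rw [intervalIntegral.integral_eq_integral_of_support_subset, hki]
        intro s hs
        have hsK : s ∈ K := by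
          by_contra h
          exact hs (hk0 s h)
        exact ⟨by linarith [(hKpq hsK).1], (hKpq hsK).2.trans hqt.le⟩
    have hχs : tsupport χ ⊆ J := by
      refine (closure_minimal (fun t ht => ?_) isClosed_Icc).trans (hJ.out (hKJ hp) (hKJ hq))
      by_contra h
      exact ht (hχ0 t h)
    have := h χ hχ1 (HasCompactSupport.intro isCompact_Icc hχ0) hχs
    have hgI := integrable_smul_of_tsupport_subset (μ := volume) hJo hI hg.continuous hgc hgs
    have hηI := integrable_smul_of_tsupport_subset (μ := volume) hJo hI hηc.continuous hηcs
      (hηt ▸ hδJ)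
    have hmI : Integrable fun r => m • η r • I r := hηI.smul m
    simp only [hχd, hk, sub_smul, mul_smul] at this
    rw [integral_sub hgI hmI, integral_smul, ← hcdef, sub_eq_zero] at this
    simp only [smul_sub]
    rw [integral_sub hgI (hgi.smul_const c), integral_smul_const, this, ← hm, sub_self]
  have hae := hJo.ae_eq_zero_of_integral_contDiff_smul_eq_zero (μ := (volume : Measure ℝ))
    ((hI.sub continuousOn_const).locallyIntegrableOn hJo.measurableSet) key
  have heq : Set.EqOn I (fun _ => c) J := by
    refine Measure.eqOn_open_of_ae_eq (μ := (volume : Measure ℝ)) ?_ hJo hI continuousOn_const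
    refine (ae_restrict_iff' hJo.measurableSet).2 ?_
    filter_upwards [hae] with t ht htJ
    exact sub_eq_zero.1 (ht htJ)
  rw [heq ha, heq hb]

lemma continuousOn_kernel_mul {J : Set ℝ} (hJ : J ⊆ Set.Ioi 0) {φ f : R3 → QH}
    (hφ : ContinuousOn φ {y | ‖y‖ ∈ J}) (hf : ContinuousOn f {y | ‖y‖ ∈ J}) :
    ContinuousOn (fun y => φ y * ((‖y‖⁻¹ • toQ y) * f y)) {y | ‖y‖ ∈ J} := by
  have h1 : ContinuousOn (fun y : R3 => ‖y‖⁻¹) {y | ‖y‖ ∈ J} :=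
    continuous_norm.continuousOn.inv₀ fun y hy => (hJ hy).ne'
  exact hφ.mul ((h1.smul (contDiff_toQ (n := 0)).continuous.continuousOn).mul hf)

lemma eventuallyEq_zero_nhds_zero {J : Set ℝ} (hJ : J ⊆ Set.Ioi 0) {g : ℝ → ℝ}
    (hs : tsupport g ⊆ J) : g =ᶠ[nhds 0] fun _ => (0 : ℝ) :=
  notMem_tsupport_iff_eventuallyEq.1 fun h => lt_irrefl (0 : ℝ) (Set.mem_Ioi.1 (hJ (hs h)))

/-- The integrals of a right-monogenic function times the normal times a left-monogenic function
over concentric spheres all agree. -/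
theorem sphereIntegral_eq {J : Set ℝ} (hJo : IsOpen J) (hJ : J ⊆ Set.Ioi 0) (hJc : J.OrdConnected)
    {φ f : R3 → QH} (hφ : ∀ y : R3, ‖y‖ ∈ J → ContDiffAt ℝ 1 φ y)
    (hf : ∀ y : R3, ‖y‖ ∈ J → ContDiffAt ℝ 1 f y)
    (hφR : ∀ y : R3, ‖y‖ ∈ J → rightCR φ y = 0) (hfL : ∀ y : R3, ‖y‖ ∈ J → CRbar f y = 0)
    {a b : ℝ} (ha : a ∈ J) (hb : b ∈ J) :
    sphereIntegral a (fun y => φ y * ((‖y‖⁻¹ • toQ y) * f y)) =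
      sphereIntegral b (fun y => φ y * ((‖y‖⁻¹ • toQ y) * f y)) := by
  have hcont := continuousOn_kernel_mul hJ
    (fun y hy => (hφ y hy).continuousAt.continuousWithinAt)
    (fun y hy => (hf y hy).continuousAt.continuousWithinAt)
  refine eq_of_integral_deriv_smul_eq_zero hJo hJc (continuousOn_sphereIntegral hJ hcont) ?_ ha hb
  intro g hg hc hs
  have h0 := eventuallyEq_zero_nhds_zero hJ hs
  rw [← integral_norm_smul hJo hJ hcont (hg.continuous_deriv (by simp)) hc.deriv
    ((tsupport_deriv_subset).trans hs)]
  simp only [← sum_fderiv_comp_norm_smul hg h0]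
  exact integral_fderiv_cutoff_eq_zero (U := {y | ‖y‖ ∈ J}) hφ hf hφR hfL
    (contDiff_comp_norm hg h0)
    (HasCompactSupport.intro (isCompact_norm_preimage hc.isCompact) fun _ hy =>
      image_eq_zero_of_notMem_tsupport hy)
    ((tsupport_comp_norm_subset g).trans fun _ hy => hs hy)

lemma appell_zero_zero (x : R3) : appell 0 0 x = 1 := by
  simp [appell]

lemma cauchyKernel_eq : cauchyKernel = fun y => star (psiFam (-2) 0 (barPt y)) := by
  funext y
  simp [psiFam, outerAppell, kelvin, appell_zero_zero, cauchyKernel, toQbar_barPt, norm_barPt,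
    Quaternion.star_smul, toQbar_eq_star y]

lemma contDiffAt_cauchyKernel {z : R3} (hz : z ≠ 0) : ContDiffAt ℝ 1 cauchyKernel z := by
  rw [cauchyKernel_eq]
  exact contDiffAt_star_psiFam _ _ hz

lemma rightCR_cauchyKernel {z : R3} (hz : z ≠ 0) : rightCR cauchyKernel z = 0 := by
  rw [cauchyKernel_eq]
  exact rightCR_star_psiFam _ _ hz

lemma rightCR_comp_sub (φ : R3 → QH) (x y : R3) :
    rightCR (fun y => φ (y - x)) y = rightCR φ (y - x) := by
  simp only [rightCR, pd, fderiv_comp_sub]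

lemma cauchyKernel_mul_normal (z : R3) (a : QH) :
    cauchyKernel z * ((‖z‖⁻¹ • toQ z) * a) = (‖z‖ ^ 2)⁻¹ • a := by
  rcases eq_or_ne z 0 with rfl | hz
  · simp
  have hz' : ‖z‖ ≠ 0 := norm_ne_zero_iff.2 hz
  rw [← mul_assoc, cauchyKernel, smul_mul_smul_comm, toQbar_mul_toQ, smul_smul, smul_mul_assoc,
    one_mul]
  congr 1
  field_simp

/-- A radial profile equal to one up to radius one and to zero from radius two on. -/
lemma exists_radial_cutoff : ∃ η : ℝ → ℝ, ContDiff ℝ 1 η ∧ (∀ t ≤ 1, η t = 1) ∧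
    ∀ t, 2 ≤ t → η t = 0 :=
  ⟨fun t => Real.smoothTransition (2 - t), Real.smoothTransition.contDiff.comp (by fun_prop),
    fun _ ht => Real.smoothTransition.one_of_one_le (by linarith),
    fun _ ht => Real.smoothTransition.zero_of_nonpos (by linarith)⟩

section Cutoff

variable {η : ℝ → ℝ}

lemma deriv_cutoff_of_lt (h1 : ∀ t ≤ 1, η t = 1) {t : ℝ} (ht : t < 1) : deriv η t = 0 := by
  have : η =ᶠ[nhds t] fun _ => 1 := by
    filter_upwards [Iio_mem_nhds ht] with s hs using h1 s (le_of_lt hs)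
  rw [this.deriv_eq, deriv_const]

lemma deriv_cutoff_of_gt (h2 : ∀ t, 2 ≤ t → η t = 0) {t : ℝ} (ht : 2 < t) : deriv η t = 0 := by
  have : η =ᶠ[nhds t] fun _ => 0 := by
    filter_upwards [Ioi_mem_nhds ht] with s hs using h2 s (le_of_lt hs)
  rw [this.deriv_eq, deriv_const]

lemma hasCompactSupport_deriv_cutoff (h1 : ∀ t ≤ 1, η t = 1) (h2 : ∀ t, 2 ≤ t → η t = 0) :
    HasCompactSupport (deriv η) := by
  refine HasCompactSupport.intro (isCompact_Icc (a := (1 : ℝ)) (b := 2)) fun t ht => ?_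
  rcases lt_or_ge t 1 with h | h
  · exact deriv_cutoff_of_lt h1 h
  · exact deriv_cutoff_of_gt h2 (lt_of_not_ge fun h' => ht ⟨h, h'⟩)

lemma continuous_deriv_cutoff_mul (hη : ContDiff ℝ 1 η) (h1 : ∀ t ≤ 1, η t = 1) :
    Continuous fun t => deriv η t * (t ^ 2)⁻¹ := by
  rw [continuous_iff_continuousAt]
  intro t
  rcases eq_or_ne t 0 with rfl | ht
  · refine (continuousAt_const (y := (0 : ℝ))).congr ?_
    filter_upwards [Iio_mem_nhds (zero_lt_one' ℝ)] with s hs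
    rw [deriv_cutoff_of_lt h1 hs, zero_mul]
  · exact (hη.continuous_deriv (by simp)).continuousAt.mul
      ((continuousAt_id.pow 2).inv₀ (pow_ne_zero 2 ht))

lemma integral_deriv_cutoff (hη : ContDiff ℝ 1 η) (h1 : ∀ t ≤ 1, η t = 1)
    (h2 : ∀ t, 2 ≤ t → η t = 0) :
    ∫ u : R3, deriv η ‖u‖ * (‖u‖ ^ 2)⁻¹ = -(4 * Real.pi) := by
  have hIoi : ∫ t in Set.Ioi (0 : ℝ), deriv η t = -1 := by
    have htend : Filter.Tendsto η Filter.atTop (nhds 0) := by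
      refine tendsto_const_nhds.congr' ?_
      filter_upwards [Filter.eventually_ge_atTop (2 : ℝ)] with t ht using (h2 t ht).symm
    rw [integral_Ioi_of_hasDerivAt_of_tendsto' (f := η) (m := 0)
      (fun t _ => (hη.differentiable (by simp) t).hasDerivAt)
      ((hη.continuous_deriv (by simp)).integrable_of_hasCompactSupport
        (hasCompactSupport_deriv_cutoff h1 h2)).integrableOn htend, h1 0 zero_le_one]
    norm_num
  have hvol : (volume : Measure R3).real (ball 0 1) = Real.pi * 4 / 3 := by
    rw [measureReal_def, EuclideanSpace.volume_ball_fin_three]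
    simp
    positivity
  rw [integral_fun_norm_addHaar (volume : Measure R3) fun t => deriv η t * (t ^ 2)⁻¹, hvol]
  rw [setIntegral_congr_fun (g := deriv η) measurableSet_Ioi, hIoi]
  · simp
    ring
  · intro t ht
    have : t ≠ 0 := (Set.mem_Ioi.1 ht).ne'
    simp
    field_simp

end Cutoff

lemma tsupport_deriv_subset_diff {g : ℝ → ℝ} {J : Set ℝ} {a : ℝ} (hs : tsupport g ⊆ J)
    (h1 : g =ᶠ[nhds a] fun _ => 1) : tsupport (deriv g) ⊆ J \ {a} := by
  refine fun t ht => ⟨hs (tsupport_deriv_subset ht), ?_⟩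
  rintro rfl
  refine notMem_tsupport_iff_eventuallyEq.2 ?_ ht
  filter_upwards [h1.eventuallyEq_nhds] with s hs'
  rw [hs'.deriv_eq, deriv_const, Pi.zero_apply]

/-- Stokes' formula with a small ball around the singularity of the Cauchy kernel removed. -/
lemma integral_cutoff_cauchyKernel {J : Set ℝ} (hJo : IsOpen J) (hJ : J ⊆ Set.Ioi 0)
    {f : R3 → QH} (hf : ∀ y : R3, ‖y‖ ∈ J → ContDiffAt ℝ 1 f y)
    (hfL : ∀ y : R3, ‖y‖ ∈ J → CRbar f y = 0) {x : R3}
    {g : ℝ → ℝ} (hg : ContDiff ℝ 1 g) (hc : HasCompactSupport g) (hs : tsupport g ⊆ J)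
    (hg1 : g =ᶠ[nhds ‖x‖] fun _ => 1) {η : ℝ → ℝ} (hη : ContDiff ℝ 1 η) (h1 : ∀ t ≤ 1, η t = 1)
    (h2 : ∀ t, 2 ≤ t → η t = 0) {ε : ℝ} (hε : 0 < ε)
    (hball : closedBall x (2 * ε) ⊆ {y : R3 | ‖y‖ ∈ J}) :
    ∫ u : R3, (deriv η ‖u‖ * (‖u‖ ^ 2)⁻¹) • f (x + ε • u) =
      ∫ y : R3, deriv g ‖y‖ • (cauchyKernel (y - x) * ((‖y‖⁻¹ • toQ y) * f y)) := by
  have hshell : IsOpen {y : R3 | ‖y‖ ∈ J} := hJo.preimage continuous_norm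
  have hfc : ContinuousOn f {y : R3 | ‖y‖ ∈ J} :=
    fun y hy => (hf y hy).continuousAt.continuousWithinAt
  set θ : ℝ → ℝ := fun t => η (ε⁻¹ * t) with hθ
  have hθc : ContDiff ℝ 1 θ := hη.comp (contDiff_const.mul contDiff_id)
  have hθ1 : ∀ t ≤ ε, θ t = 1 := fun t ht => h1 _ (by
    rw [inv_mul_le_iff₀ hε, mul_one]; exact ht)
  have hθ2 : ∀ t, 2 * ε ≤ t → θ t = 0 := fun t ht => h2 _ (by
    rw [le_inv_mul_iff₀ hε, mul_comm]; exact ht)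
  have hθ0 : θ =ᶠ[nhds 0] fun _ => 1 := by
    filter_upwards [Iio_mem_nhds hε] with t ht using hθ1 t (le_of_lt ht)
  have hg0 := eventuallyEq_zero_nhds_zero hJ hs
  have hgc := contDiff_comp_norm hg hg0
  have hθn := contDiff_comp_norm hθc hθ0
  have hθx : ContDiff ℝ 1 fun y : R3 => θ ‖y - x‖ := hθn.comp (contDiff_id.sub contDiff_const)
  set χ : R3 → ℝ := fun y => g ‖y‖ - θ ‖y - x‖ with hχ
  have hχc : ContDiff ℝ 1 χ := hgc.sub hθx
  set K : Set R3 := {y | ‖y‖ ∈ tsupport g} ∪ closedBall x (2 * ε) with hK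
  have hKc : IsCompact K :=
    (isCompact_norm_preimage hc.isCompact).union (isCompact_closedBall _ _)
  have hχ0 : ∀ y ∉ K, χ y = 0 := by
    intro y hy
    have e1 : g ‖y‖ = 0 := image_eq_zero_of_notMem_tsupport fun h => hy (Or.inl h)
    have e2 : θ ‖y - x‖ = 0 := hθ2 _ (by
      by_contra h
      exact hy (Or.inr (by rw [mem_closedBall, dist_eq_norm]; linarith)))
    simp only [hχ, e1, e2, sub_self]
  have hχx : χ =ᶠ[nhds x] 0 := by
    have t1 : Filter.Tendsto (fun y : R3 => ‖y‖) (nhds x) (nhds ‖x‖) := continuous_norm.tendsto x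
    filter_upwards [t1.eventually hg1, ball_mem_nhds x hε] with y hy1 hy2
    rw [mem_ball, dist_eq_norm] at hy2
    simp [hχ, hy1, hθ1 _ hy2.le]
  have hχs : tsupport χ ⊆ {y | ‖y‖ ∈ J ∧ y ≠ x} := by
    intro y hy
    refine ⟨?_, ?_⟩
    · have hyK : y ∈ K := closure_minimal (fun z hz => by
        by_contra h
        exact hz (hχ0 z h)) hKc.isClosed hy
      rcases hyK with h | h
      · exact hs h
      · exact hball h
    · rintro rfl
      exact notMem_tsupport_iff_eventuallyEq.2 hχx hy
  have hst := integral_fderiv_cutoff_eq_zero (U := {y | ‖y‖ ∈ J ∧ y ≠ x})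
    (φ := fun y => cauchyKernel (y - x)) (f := f) (χ := χ)
    (fun y hy => (contDiffAt_cauchyKernel (sub_ne_zero.2 hy.2)).comp y
      (contDiffAt_id.sub contDiffAt_const))
    (fun y hy => hf y hy.1)
    (fun y hy => by rw [rightCR_comp_sub, rightCR_cauchyKernel (sub_ne_zero.2 hy.2)])
    (fun y hy => hfL y hy.1) hχc (HasCompactSupport.intro hKc hχ0) hχs
  have hW : ∀ y : R3, deriv θ ‖y - x‖ * (‖y - x‖ ^ 2)⁻¹ =
      (ε ^ 3)⁻¹ * (deriv η ‖ε⁻¹ • (y - x)‖ * (‖ε⁻¹ • (y - x)‖ ^ 2)⁻¹) := by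
    intro y
    have e : deriv θ ‖y - x‖ = ε⁻¹ * deriv η (ε⁻¹ * ‖y - x‖) := by
      rw [hθ, deriv_comp_mul_left, smul_eq_mul]
    rw [e, norm_smul, Real.norm_of_nonneg (inv_pos.2 hε).le, mul_pow, mul_inv]
    field_simp
  have hsum : ∀ y : R3, ∑ i, fderiv ℝ χ y (EuclideanSpace.single i 1) •
      (cauchyKernel (y - x) * (eB i * f y)) =
      deriv g ‖y‖ • (cauchyKernel (y - x) * ((‖y‖⁻¹ • toQ y) * f y)) -
        (deriv θ ‖y - x‖ * (‖y - x‖ ^ 2)⁻¹) • f y := by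
    intro y
    have hd : ∀ i, fderiv ℝ χ y (EuclideanSpace.single i 1) =
        fderiv ℝ (fun y : R3 => g ‖y‖) y (EuclideanSpace.single i 1) -
          fderiv ℝ (fun y : R3 => θ ‖y‖) (y - x) (EuclideanSpace.single i 1) := by
      intro i
      rw [hχ, fderiv_fun_sub (hgc.differentiable (by simp) y) (hθx.differentiable (by simp) y),
        fderiv_comp_sub (f := fun y : R3 => θ ‖y‖)]
      rfl
    simp only [hd, sub_smul, Finset.sum_sub_distrib]
    rw [sum_fderiv_comp_norm_smul hg hg0, sum_fderiv_comp_norm_smul hθc hθ0,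
      cauchyKernel_mul_normal, smul_smul]
  have hi1 : Integrable fun y : R3 =>
      deriv g ‖y‖ • (cauchyKernel (y - x) * ((‖y‖⁻¹ • toQ y) * f y)) := by
    refine integrable_norm_smul (J := J \ {‖x‖}) (hJo.sdiff isClosed_singleton) ?_
      (hg.continuous_deriv (by simp)) hc.deriv (tsupport_deriv_subset_diff hs hg1)
    refine continuousOn_kernel_mul (Set.sdiff_subset.trans hJ) (fun y hy => ?_)
      (hfc.mono fun y hy => hy.1)
    have hyx : y - x ≠ 0 := sub_ne_zero.2 fun h => hy.2 (by rw [h]; rfl)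
    exact ((contDiffAt_cauchyKernel hyx).continuousAt.comp
      (f := fun y => y - x) (by fun_prop)).continuousWithinAt
  have hi2 : Integrable fun y : R3 => (deriv θ ‖y - x‖ * (‖y - x‖ ^ 2)⁻¹) • f y := by
    have h0 : ∀ y ∉ closedBall x (2 * ε), deriv θ ‖y - x‖ * (‖y - x‖ ^ 2)⁻¹ = 0 := by
      intro y hy
      rw [mem_closedBall, dist_eq_norm, not_le] at hy
      have : θ =ᶠ[nhds ‖y - x‖] fun _ => 0 := by
        filter_upwards [Ioi_mem_nhds hy] with s hs using hθ2 s (le_of_lt hs)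
      rw [this.deriv_eq, deriv_const, zero_mul]
    refine integrable_smul_of_tsupport_subset hshell hfc ?_
      (HasCompactSupport.intro (isCompact_closedBall x (2 * ε)) h0)
      ((closure_minimal (fun y hy => ?_) isClosed_closedBall).trans hball)
    · simp only [hW]
      exact continuous_const.mul ((continuous_deriv_cutoff_mul hη h1).comp (by fun_prop :
        Continuous fun y : R3 => ‖ε⁻¹ • (y - x)‖))
    · by_contra h
      exact hy (h0 y h)
  simp only [hsum] at hst
  rw [integral_sub hi1 hi2, sub_eq_zero] at hst
  rw [hst]
  set H : R3 → QH := fun u => (deriv η ‖u‖ * (‖u‖ ^ 2)⁻¹) • f (x + ε • u) with hH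
  have hHy : ∀ y, (deriv θ ‖y - x‖ * (‖y - x‖ ^ 2)⁻¹) • f y = (ε ^ 3)⁻¹ • H (ε⁻¹ • (y - x)) := by
    intro y
    rw [hW, mul_smul]
    simp only [hH, smul_smul, mul_inv_cancel₀ hε.ne', one_smul, add_sub_cancel]
  simp only [hHy]
  rw [integral_smul, integral_sub_right_eq_self (fun z => H (ε⁻¹ • z)) x, Measure.integral_comp_smul,
    finrank_euclideanSpace_fin, smul_smul, inv_pow, inv_inv, abs_of_pos (by positivity),
    inv_mul_cancel₀ (by positivity), one_smul]

/-- The Cauchy-Pompeiu representation formula, with a radial cut-off. -/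
theorem integral_deriv_smul_sphereIntegral_cauchyKernel {J : Set ℝ} (hJo : IsOpen J)
    (hJ : J ⊆ Set.Ioi 0) {f : R3 → QH} (hf : ∀ y : R3, ‖y‖ ∈ J → ContDiffAt ℝ 1 f y)
    (hfL : ∀ y : R3, ‖y‖ ∈ J → CRbar f y = 0) {x : R3} (hx : ‖x‖ ∈ J)
    {g : ℝ → ℝ} (hg : ContDiff ℝ 1 g) (hc : HasCompactSupport g) (hs : tsupport g ⊆ J)
    (hg1 : g =ᶠ[nhds ‖x‖] fun _ => 1) :
    ∫ r, deriv g r • sphereIntegral r (fun y => cauchyKernel (y - x) * ((‖y‖⁻¹ • toQ y) * f y)) =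
      -((4 * Real.pi) • f x) := by
  obtain ⟨η, hη, h1, h2⟩ := exists_radial_cutoff
  have hshell : IsOpen {y : R3 | ‖y‖ ∈ J} := hJo.preimage continuous_norm
  obtain ⟨δ, hδ, hball⟩ := Metric.isOpen_iff.1 hshell x hx
  set T : ℝ → QH := fun ε => ∫ u : R3, (deriv η ‖u‖ * (‖u‖ ^ 2)⁻¹) • f (x + ε • u) with hT
  have hT0 : T 0 = -((4 * Real.pi) • f x) := by
    simp only [hT, zero_smul, add_zero]
    rw [integral_smul_const, integral_deriv_cutoff hη h1 h2, neg_smul]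
  have hw := (continuous_deriv_cutoff_mul hη h1).comp (continuous_norm (E := R3))
  have hcont : ContinuousOn T (Set.Ioo (-(δ / 3)) (δ / 3)) := by
    refine continuousOn_integral_of_compact_support (isCompact_closedBall (0 : R3) 2) ?_ ?_
    · intro p hp
      refine ContinuousAt.continuousWithinAt ?_
      rcases lt_or_ge ‖p.2‖ 3 with h3 | h3
      · have hmem : ‖x + p.1 • p.2‖ ∈ J := by
          refine hball ?_
          have h4 : |p.1| < δ / 3 := abs_lt.2 hp.1
          rw [mem_ball, dist_eq_norm, add_sub_cancel_left, norm_smul, Real.norm_eq_abs]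
          nlinarith [abs_nonneg p.1, norm_nonneg p.2]
        refine ContinuousAt.smul (f := fun p : ℝ × R3 => deriv η ‖p.2‖ * (‖p.2‖ ^ 2)⁻¹)
          (g := fun p : ℝ × R3 => f (x + p.1 • p.2)) (hw.comp continuous_snd).continuousAt ?_
        exact ContinuousAt.comp (f := fun p : ℝ × R3 => x + p.1 • p.2) (hf _ hmem).continuousAt
          (by fun_prop)
      · refine (continuousAt_const (y := (0 : QH))).congr ?_
        have : {q : ℝ × R3 | 2 < ‖q.2‖} ∈ nhds p :=
          (isOpen_lt continuous_const (by fun_prop)).mem_nhds (by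
            show 2 < ‖p.2‖
            linarith)
        filter_upwards [this] with q hq
        simp only [Function.uncurry, deriv_cutoff_of_gt h2 hq, zero_mul, zero_smul]
    · intro ε u _ hu
      rw [mem_closedBall, dist_zero_right, not_le] at hu
      rw [deriv_cutoff_of_gt h2 hu, zero_mul, zero_smul]
  set C := ∫ y : R3, deriv g ‖y‖ • (cauchyKernel (y - x) * ((‖y‖⁻¹ • toQ y) * f y)) with hC
  have hTC : ∀ ε ∈ Set.Ioo 0 (δ / 3), T ε = C := fun ε hε =>
    integral_cutoff_cauchyKernel hJo hJ hf hfL hg hc hs hg1 hη h1 h2 hε.1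
      ((closedBall_subset_ball (by linarith [hε.2, hε.1])).trans hball)
  have hTlim : Filter.Tendsto T (nhdsWithin 0 (Set.Ioi 0)) (nhds (T 0)) :=
    ((hcont.continuousAt (Ioo_mem_nhds (by linarith) (by linarith))).tendsto).mono_left
      nhdsWithin_le_nhds
  have hClim : Filter.Tendsto T (nhdsWithin 0 (Set.Ioi 0)) (nhds C) := by
    refine tendsto_const_nhds.congr' ?_
    filter_upwards [Ioo_mem_nhdsGT (by linarith : (0 : ℝ) < δ / 3)] with ε hε using (hTC ε hε).symm
  rw [← hT0, tendsto_nhds_unique hTlim hClim, hC]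
  refine (integral_norm_smul (J := J \ {‖x‖}) (hJo.sdiff isClosed_singleton)
    (Set.sdiff_subset.trans hJ) ?_ (hg.continuous_deriv (by simp)) hc.deriv
    (tsupport_deriv_subset_diff hs hg1)).symm
  refine continuousOn_kernel_mul (Set.sdiff_subset.trans hJ) (fun y hy => ?_)
    (fun y hy => (hf y hy.1).continuousAt.continuousWithinAt)
  have hyx : y - x ≠ 0 := sub_ne_zero.2 fun h => hy.2 (by rw [h]; rfl)
  exact ((contDiffAt_cauchyKernel hyx).continuousAt.comp
    (f := fun y => y - x) (by fun_prop)).continuousWithinAt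

lemma psiFam_natCast (n l : ℕ) : psiFam (n : ℤ) l = appell n l := by
  rw [psiFam_eq, if_pos (Int.natCast_nonneg n), Int.toNat_natCast]

lemma psiFam_neg_natCast (n l : ℕ) : psiFam (-((n : ℤ) + 2)) l = outerAppell n l := by
  rw [psiFam_eq, if_neg (by omega)]
  congr
  omega

lemma continuous_smul_sphere {r : ℝ} (hr : 0 < r) {G : R3 → QH}
    (hG : ContinuousOn G {y | ‖y‖ = r}) :
    Continuous fun u : sphere (0 : R3) 1 => r ^ 2 • G (r • (u : R3)) :=
  continuous_const.fun_smul
    (hG.comp_continuous (by fun_prop) fun u => norm_smul_sphere hr u)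

lemma integrable_smul_sphere {r : ℝ} (hr : 0 < r) {G : R3 → QH}
    (hG : ContinuousOn G {y | ‖y‖ = r}) :
    Integrable (fun u : sphere (0 : R3) 1 => r ^ 2 • G (r • (u : R3)))
      (volume : Measure R3).toSphere :=
  (continuous_smul_sphere hr hG).integrable_of_hasCompactSupport
    (HasCompactSupport.of_compactSpace _)

lemma sphereIntegral_smul (r c : ℝ) (G : R3 → QH) :
    sphereIntegral r (fun y => c • G y) = c • sphereIntegral r G := by
  simp only [sphereIntegral, smul_comm _ c]
  exact integral_smul _ _

lemma sphereIntegral_const_mul {r : ℝ} (hr : 0 < r) (a : QH) {G : R3 → QH}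
    (hG : ContinuousOn G {y | ‖y‖ = r}) :
    sphereIntegral r (fun y => a * G y) = a * sphereIntegral r G := by
  simp only [sphereIntegral, ← mul_smul_comm]
  exact integral_const_mul_of_integrable (integrable_smul_sphere hr hG)

lemma sphereIntegral_sum {r : ℝ} (hr : 0 < r) {ι : Type*} (s : Finset ι) {G : ι → R3 → QH}
    (hG : ∀ i, ContinuousOn (G i) {y | ‖y‖ = r}) :
    sphereIntegral r (fun y => ∑ i ∈ s, G i y) = ∑ i ∈ s, sphereIntegral r (G i) := by
  simp only [sphereIntegral, Finset.smul_sum]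
  exact integral_finsetSum _ fun i _ => integrable_smul_sphere hr (hG i)

lemma hasSum_sphereIntegral {r : ℝ} (hr : 0 < r) {F : ℕ → R3 → QH} {G : R3 → QH} {b : ℕ → ℝ}
    (hF : ∀ n, ContinuousOn (F n) {y | ‖y‖ = r}) (hb : ∀ n, ∀ y : R3, ‖y‖ = r → ‖F n y‖ ≤ b n)
    (hs : Summable b) (h : ∀ y : R3, ‖y‖ = r → HasSum (fun n => F n y) (G y)) :
    HasSum (fun n => sphereIntegral r (F n)) (sphereIntegral r G) := by
  refine hasSum_integral_of_dominated_convergence (fun n _ => r ^ 2 * b n)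
    (fun n => (integrable_smul_sphere hr (hF n)).aestronglyMeasurable) (fun n => ?_) ?_ ?_ ?_
  · refine Filter.Eventually.of_forall fun u => ?_
    rw [norm_smul, Real.norm_of_nonneg (sq_nonneg r)]
    gcongr
    exact hb n _ (norm_smul_sphere hr u)
  · exact Filter.Eventually.of_forall fun u => hs.mul_left _
  · exact integrable_const _
  · exact Filter.Eventually.of_forall fun u => (h _ (norm_smul_sphere hr u)).const_smul _

/-- Termwise integration of an expansion of the Cauchy kernel over a sphere. -/
lemma hasSum_mul_sphereIntegral {r : ℝ} (hr : 0 < r) {N : R3 → QH}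
    (hN : ContinuousOn N {y | ‖y‖ = r}) {A : ℕ → ℕ → QH} {ψ : ℕ → ℕ → R3 → QH}
    (hψ : ∀ n l, ContinuousOn (ψ n l) {y | ‖y‖ = r}) {κ : ℕ → R3 → QH} {b : ℕ → ℝ}
    (hκ : ∀ n, ∀ y : R3, ∑ l ∈ range (n + 1), (((n : ℝ) + 1) / 4 ^ l) • (A n l * ψ n l y) = κ n y)
    (hb : ∀ n, ∀ y : R3, ‖y‖ = r → ‖κ n y‖ ≤ b n) (hs : Summable b) {E : R3 → QH}
    (hE : ∀ y : R3, ‖y‖ = r → HasSum (fun n => κ n y) (E y)) :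
    HasSum (fun n : ℕ => ∑ l ∈ range (n + 1), A n l *
        ((((n : ℝ) + 1) / (4 ^ (l + 1) * Real.pi)) • sphereIntegral r fun y => ψ n l y * N y))
      ((4 * Real.pi)⁻¹ • sphereIntegral r fun y => E y * N y) := by
  have hcomp : IsCompact {y : R3 | ‖y‖ = r} := isCompact_norm_preimage (K := {r}) isCompact_singleton
  obtain ⟨M, hM⟩ := hcomp.exists_bound_of_continuousOn hN
  have hcont : ∀ n l, ContinuousOn (fun y => A n l * (ψ n l y * N y)) {y | ‖y‖ = r} :=
    fun n l => continuousOn_const.mul ((hψ n l).mul hN)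
  have hcs : ∀ n l : ℕ, ContinuousOn
      (fun y => (((n : ℝ) + 1) / 4 ^ l) • (A n l * (ψ n l y * N y))) {y | ‖y‖ = r} :=
    fun n l => continuousOn_const.fun_smul (hcont n l)
  have hterm : ∀ n y, κ n y * N y = ∑ l ∈ range (n + 1),
      (((n : ℝ) + 1) / 4 ^ l) • (A n l * (ψ n l y * N y)) := by
    intro n y
    rw [← hκ, Finset.sum_mul]
    simp only [smul_mul_assoc, mul_assoc]
  have hsum := hasSum_sphereIntegral hr (F := fun n y => κ n y * N y) (G := fun y => E y * N y)
    (b := fun n => b n * M)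
    (fun n => by
      simp only [hterm]
      exact continuousOn_finsetSum _ fun l _ => hcs n l)
    (fun n y hy => by
      rw [norm_mul]
      exact mul_le_mul (hb n y hy) (hM y hy) (norm_nonneg _) ((norm_nonneg _).trans (hb n y hy)))
    (hs.mul_right M) fun y hy => (hE y hy).mul_right _
  refine (hsum.const_smul (4 * Real.pi)⁻¹).congr_fun fun n => ?_
  simp only [hterm]
  rw [sphereIntegral_sum hr _ (hcs n), Finset.smul_sum]
  refine Finset.sum_congr rfl fun l _ => ?_
  rw [sphereIntegral_smul, sphereIntegral_const_mul hr _ ((hψ n l).fun_mul hN), mul_smul_comm, smul_smul]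
  congr 1
  field_simp
  ring

lemma continuousOn_normal_mul {r : ℝ} (hr : 0 < r) {f : R3 → QH}
    (hf : ContinuousOn f {y | ‖y‖ = r}) :
    ContinuousOn (fun y => (‖y‖⁻¹ • toQ y) * f y) {y | ‖y‖ = r} := by
  have := continuousOn_kernel_mul (J := {r}) (φ := fun _ => 1) (by simpa using hr)
    continuousOn_const hf
  simpa using this

lemma ne_zero_of_norm_eq {r : ℝ} (hr : 0 < r) {y : R3} (hy : ‖y‖ = r) : y ≠ 0 :=
  norm_ne_zero_iff.1 (hy ▸ hr.ne')

/-- The regular part of the Laurent series is a Cauchy integral over a large sphere. -/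
theorem hasSum_laurent_regular {r : ℝ} {f : R3 → QH} (hf : ContinuousOn f {y | ‖y‖ = r}) {x : R3}
    (hx : ‖x‖ < r) :
    HasSum (fun n : ℕ => ∑ l ∈ range (n + 1), psiFam n l x * laurentCoeff f r n l)
      ((4 * Real.pi)⁻¹ • sphereIntegral r fun y =>
        cauchyKernel (y - x) * ((‖y‖⁻¹ • toQ y) * f y)) := by
  have hr : 0 < r := (norm_nonneg x).trans_lt hx
  refine (hasSum_mul_sphereIntegral hr (continuousOn_normal_mul hr hf) (A := fun n l => appell n l x)
    (ψ := fun n l y => star (outerAppell n l (barPt y)))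
    (b := fun n => (r ^ 2)⁻¹ * (((n : ℝ) + 1) ^ 2 * (‖x‖ / r) ^ n))
    (fun n l y hy => ?_) (fun n y => sum_appell_mul_outerAppell n x y) (fun n y hy => ?_) ?_
    fun y hy => hasSum_kernelTerm (by rwa [hy])).congr_fun fun n => ?_
  · have := contDiffAt_star_psiFam (-((n : ℤ) + 2)) l (ne_zero_of_norm_eq hr hy)
    rw [psiFam_neg_natCast] at this
    exact this.continuousAt.continuousWithinAt
  · simpa [hy] using norm_kernelTerm_le (x := x) n (ne_zero_of_norm_eq hr hy)
  · exact (summable_sq_mul_pow (by positivity) ((div_lt_one hr).2 hx)).mul_left _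
  · refine Finset.sum_congr rfl fun l _ => ?_
    have hn : ((n : ℤ) + 1).natAbs = n + 1 := by omega
    simp only [laurentCoeff, psiFam_natCast, psiFam_neg_natCast, hn, Nat.cast_add, Nat.cast_one]

/-- The principal part of the Laurent series is a Cauchy integral over a small sphere. -/
theorem hasSum_laurent_principal {r : ℝ} (hr : 0 < r) {f : R3 → QH}
    (hf : ContinuousOn f {y | ‖y‖ = r}) {x : R3} (hx : r < ‖x‖) :
    HasSum (fun n : ℕ => ∑ l ∈ range (n + 1),
        psiFam (-((n : ℤ) + 2)) l x * laurentCoeff f r (-((n : ℤ) + 2)) l)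
      (-((4 * Real.pi)⁻¹ • sphereIntegral r fun y =>
        cauchyKernel (y - x) * ((‖y‖⁻¹ • toQ y) * f y))) := by
  have hx0 : 0 < ‖x‖ := hr.trans hx
  have hE : ∀ y : R3, cauchyKernel (y - x) = (-1 : ℝ) • cauchyKernel (x - y) := by
    intro y
    rw [cauchyKernel, cauchyKernel, norm_sub_rev y x, ← neg_sub x y, ← neg_one_smul ℝ (x - y),
      toQbar_smul, smul_comm]
  have e : (fun y => cauchyKernel (y - x) * ((‖y‖⁻¹ • toQ y) * f y)) =
      fun y => (-1 : ℝ) • (cauchyKernel (x - y) * ((‖y‖⁻¹ • toQ y) * f y)) :=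
    funext fun y => by rw [hE, smul_mul_assoc]
  rw [e, sphereIntegral_smul, neg_one_smul, smul_neg, neg_neg]
  refine (hasSum_mul_sphereIntegral hr (continuousOn_normal_mul hr hf)
    (A := fun n l => outerAppell n l x) (ψ := fun n l y => star (appell n l (barPt y)))
    (b := fun n => (‖x‖ ^ 2)⁻¹ * (((n : ℝ) + 1) ^ 2 * (r / ‖x‖) ^ n))
    (fun n l y hy => ?_) (fun n y => sum_outerAppell_mul_appell n x y) (fun n y hy => ?_) ?_
    fun y hy => hasSum_star_kernelTerm (by rwa [hy])).congr_fun fun n => ?_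
  · have := contDiffAt_star_psiFam (n : ℤ) l (ne_zero_of_norm_eq hr hy)
    rw [psiFam_natCast] at this
    exact this.continuousAt.continuousWithinAt
  · have := norm_kernelTerm_le (x := barPt y) n (barPt_ne_zero (ne_zero_of_norm_eq hx0 rfl))
    rw [norm_barPt, norm_barPt, hy] at this
    rwa [norm_star]
  · exact (summable_sq_mul_pow (by positivity) ((div_lt_one hx0).2 hx)).mul_left _
  · refine Finset.sum_congr rfl fun l _ => ?_
    have hn : (-((n : ℤ) + 2) + 1).natAbs = n + 1 := by omega
    have hn' : -(-((n : ℤ) + 2) + 2) = n := by omega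
    simp only [laurentCoeff, psiFam_natCast, psiFam_neg_natCast, hn, hn', Nat.cast_add,
      Nat.cast_one]

lemma integral_deriv_smul_of_eq {g : ℝ → ℝ} (hg : ContDiff ℝ 1 g) (hc : HasCompactSupport g)
    {a : ℝ} {S : ℝ → QH} {p q : QH} (hp : ∀ r, a < r → deriv g r ≠ 0 → S r = p)
    (hq : ∀ r, r ≤ a → deriv g r ≠ 0 → S r = q) :
    ∫ r, deriv g r • S r = g a • (q - p) := by
  have hint : Integrable (deriv g) :=
    (hg.continuous_deriv le_rfl).integrable_of_hasCompactSupport hc.deriv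
  have hI : Set.EqOn (fun r => deriv g r • S r) (fun r => deriv g r • p) (Set.Ioi a) := by
    intro r hr
    by_cases h : deriv g r = 0
    · simp [h]
    · simp only [hp r hr h]
  have hL : Set.EqOn (fun r => deriv g r • S r) (fun r => deriv g r • q) (Set.Iic a) := by
    intro r hr
    by_cases h : deriv g r = 0
    · simp [h]
    · simp only [hq r hr h]
  rw [← intervalIntegral.integral_Iic_add_Ioi (b := a)
      ((hint.smul_const q).integrableOn.congr_fun hL.symm measurableSet_Iic)
      ((hint.smul_const p).integrableOn.congr_fun hI.symm measurableSet_Ioi),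
    setIntegral_congr_fun measurableSet_Iic hL, setIntegral_congr_fun measurableSet_Ioi hI,
    integral_smul_const, integral_smul_const, hc.integral_Iic_deriv_eq hg,
    hc.integral_Ioi_deriv_eq hg, neg_smul, smul_sub, sub_eq_add_neg]

section Shell

variable {J : Set ℝ} {f : R3 → QH}

/-- The Laurent coefficients do not depend on the radius. -/
theorem laurentCoeff_eq (hJo : IsOpen J) (hJ : J ⊆ Set.Ioi 0) (hJc : J.OrdConnected)
    (hf : ∀ y, ‖y‖ ∈ J → ContDiffAt ℝ 1 f y) (hfL : ∀ y, ‖y‖ ∈ J → CRbar f y = 0) {a b : ℝ}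
    (ha : a ∈ J) (hb : b ∈ J) (k : ℤ) (l : ℕ) : laurentCoeff f a k l = laurentCoeff f b k l := by
  have h0 : ∀ y : R3, ‖y‖ ∈ J → y ≠ 0 := fun y hy => norm_pos_iff.1 (hJ hy)
  rw [laurentCoeff, laurentCoeff,
    sphereIntegral_eq hJo hJ hJc (fun y hy => contDiffAt_star_psiFam (-(k + 2)) l (h0 y hy)) hf
      (fun y hy => rightCR_star_psiFam (-(k + 2)) l (h0 y hy)) hfL ha hb]

/-- The Laurent expansion on the shell of points whose norm lies in an open interval. -/
theorem hasSum_laurent (hJo : IsOpen J) (hJ : J ⊆ Set.Ioi 0) (hJc : J.OrdConnected)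
    (hf : ∀ y, ‖y‖ ∈ J → ContDiffAt ℝ 1 f y) (hfL : ∀ y, ‖y‖ ∈ J → CRbar f y = 0) {ρ : ℝ}
    (hρ : ρ ∈ J) {x : R3} (hx : ‖x‖ ∈ J) :
    HasSum (fun k : ℤ => ∑ l ∈ range (k + 1).natAbs, psiFam k l x * laurentCoeff f ρ k l)
      (f x) := by
  set F : ℤ → QH := fun k => ∑ l ∈ range (k + 1).natAbs, psiFam k l x * laurentCoeff f ρ k l
    with hF
  set S : ℝ → QH := fun r => sphereIntegral r fun y =>
    cauchyKernel (y - x) * ((‖y‖⁻¹ • toQ y) * f y)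
  have hcont : ∀ r ∈ J, ContinuousOn f {y | ‖y‖ = r} := fun r hr y hy =>
    (hf y (by rwa [show ‖y‖ = r from hy])).continuousAt.continuousWithinAt
  have hreg : ∀ r ∈ J, ‖x‖ < r → HasSum (fun n : ℕ => F n) ((4 * Real.pi)⁻¹ • S r) := by
    intro r hr hxr
    refine (hasSum_laurent_regular (hcont r hr) hxr).congr_fun fun n => ?_
    have hn : ((n : ℤ) + 1).natAbs = n + 1 := by omega
    simp only [hF, hn, laurentCoeff_eq hJo hJ hJc hf hfL hρ hr]
  have hprin : ∀ r ∈ J, r < ‖x‖ →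
      HasSum (fun n : ℕ => F (-((n : ℤ) + 2))) (-((4 * Real.pi)⁻¹ • S r)) := by
    intro r hr hxr
    refine (hasSum_laurent_principal (hJ hr) (hcont r hr) hxr).congr_fun fun n => ?_
    have hn : (-((n : ℤ) + 2) + 1).natAbs = n + 1 := by omega
    simp only [hF, hn, laurentCoeff_eq hJo hJ hJc hf hfL hρ hr]
  obtain ⟨δ, hδ, hball⟩ := Metric.nhds_basis_closedBall.mem_iff.1 (hJo.mem_nhds hx)
  have hmem : ∀ r, |r - ‖x‖| ≤ δ → r ∈ J := fun r hr => hball (by rwa [mem_closedBall, Real.dist_eq])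
  have hb : ‖x‖ + δ ∈ J := hmem _ (by rw [add_sub_cancel_left, abs_of_pos hδ])
  have ha : ‖x‖ - δ ∈ J := hmem _ (by rw [sub_sub_cancel_left, abs_neg, abs_of_pos hδ])
  have hP := hreg _ hb (lt_add_of_pos_right _ hδ)
  have hN := hprin _ ha (sub_lt_self _ hδ)
  have hπ : (4 * Real.pi : ℝ) ≠ 0 := by positivity
  let g : ContDiffBump ‖x‖ := ⟨δ / 2, δ, half_pos hδ, half_lt_self hδ⟩
  have hg1 : (g : ℝ → ℝ) =ᶠ[nhds ‖x‖] fun _ => 1 := g.eventuallyEq_one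
  have hgJ : tsupport (g : ℝ → ℝ) ⊆ J := by rwa [g.tsupport_eq]
  have hg : ContDiff ℝ 1 (g : ℝ → ℝ) := g.contDiff (n := 1)
  have hdJ : ∀ r, deriv g r ≠ 0 → r ∈ J := fun r hr =>
    hgJ (tsupport_deriv_subset (subset_tsupport _ hr))
  have hdx : deriv g ‖x‖ = 0 := by rw [hg1.deriv_eq, deriv_const]
  have hint := integral_deriv_smul_of_eq hg g.hasCompactSupport (a := ‖x‖) (S := S)
    (p := S (‖x‖ + δ)) (q := S (‖x‖ - δ))
    (fun r hr h => smul_right_injective QH (inv_ne_zero hπ) ((hreg r (hdJ r h) hr).unique hP))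
    (fun r hr h => smul_right_injective QH (inv_ne_zero hπ) (neg_injective ((hprin r (hdJ r h)
      (hr.lt_of_ne fun e => h (e ▸ hdx))).unique hN)))
  rw [integral_deriv_smul_sphereIntegral_cauchyKernel hJo hJ hf hfL hx hg g.hasCompactSupport hgJ
    hg1, hg1.self_of_nhds, one_smul] at hint
  have hfx : f x = (4 * Real.pi)⁻¹ • S (‖x‖ + δ) + -((4 * Real.pi)⁻¹ • S (‖x‖ - δ)) := by
    rw [← sub_eq_add_neg, ← smul_sub, ← neg_sub (S (‖x‖ - δ)), ← hint, neg_neg, smul_smul,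
      inv_mul_cancel₀ hπ, one_smul]
  rw [hfx]
  refine HasSum.of_nat_of_neg_add_one hP ?_
  have h0 : F (-(((0 : ℕ) : ℤ) + 1)) = 0 := by simp [hF]
  have := (hasSum_nat_add_iff (f := fun n : ℕ => F (-((n : ℤ) + 1))) 1).1
    (hN.congr_fun fun n => by push_cast; congr 1)
  rwa [Finset.sum_range_one, h0, add_zero] at this

end Shell

/-- the Laurent series expansion of a monogenic function on a spherical
shell: the coefficients do not depend on the radius ρ, and the series converges
pointwise to f on the shell. -/
theorem laurent_series_expansion (ξ₁ : ℝ) (ξ₂ : EReal) (hξ₁ : 0 ≤ ξ₁)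
    (hξ : (ξ₁ : EReal) < ξ₂) (f : R3 → QH)
    (hf1 : ContDiffOn ℝ 1 f {x : R3 | ξ₁ < ‖x‖ ∧ (‖x‖ : EReal) < ξ₂})
    (hmono : ∀ x : R3, ξ₁ < ‖x‖ → (‖x‖ : EReal) < ξ₂ → CRbar f x = 0) :
    (∀ ρ ρ' : ℝ, ξ₁ < ρ → (ρ : EReal) < ξ₂ → ξ₁ < ρ' → (ρ' : EReal) < ξ₂ →
      ∀ (k : ℤ) (l : ℕ), laurentCoeff f ρ k l = laurentCoeff f ρ' k l) ∧
    (∀ ρ : ℝ, ξ₁ < ρ → (ρ : EReal) < ξ₂ →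
      ∀ x : R3, ξ₁ < ‖x‖ → (‖x‖ : EReal) < ξ₂ →
        HasSum (fun k : ℤ =>
          ∑ l ∈ Finset.range (k + 1).natAbs, psiFam k l x * laurentCoeff f ρ k l)
          (f x)) := by
  set J : Set ℝ := {r | ξ₁ < r ∧ (r : EReal) < ξ₂}
  have hJo : IsOpen J := (isOpen_lt continuous_const continuous_id).inter
    (isOpen_lt continuous_coe_real_ereal continuous_const)
  have hJ : J ⊆ Set.Ioi 0 := fun r hr => hξ₁.trans_lt hr.1
  have hJc : J.OrdConnected := ⟨fun a ha b hb r hr =>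
    ⟨ha.1.trans_le hr.1, (EReal.coe_le_coe_iff.2 hr.2).trans_lt hb.2⟩⟩
  have hf : ∀ y : R3, ‖y‖ ∈ J → ContDiffAt ℝ 1 f y := fun y hy =>
    hf1.contDiffAt ((hJo.preimage continuous_norm).mem_nhds hy)
  have hfL : ∀ y : R3, ‖y‖ ∈ J → CRbar f y = 0 := fun y hy => hmono y hy.1 hy.2
  exact ⟨fun ρ ρ' h₁ h₂ h₁' h₂' k l =>
      laurentCoeff_eq hJo hJ hJc hf hfL ⟨h₁, h₂⟩ ⟨h₁', h₂'⟩ k l,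
    fun ρ h₁ h₂ x hx₁ hx₂ => hasSum_laurent hJo hJ hJc hf hfL ⟨h₁, h₂⟩ ⟨hx₁, hx₂⟩⟩
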